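/- arXiv:2002.12264 — 2 statements merged into one kernel-verified Lean document; each statement's English description precedes it below -/
import Mathlib

section
/- Let 1 ≤ p ≤ ∞, 1 ≤ q < ∞ and f ∈ RM(p,q). Then ρ_{p,q}(f - f_r) → 0 as r → 1⁻, where f_r(z) = f(rz). -/
open MeasureTheory Complex Real ENNReal

/-- Radial `L^p` average `( ∫₀¹ |f(r e^{iθ})|^p dr )^{1/p}` (sup over `r` if `p = ∞`),
valued in `ℝ≥0∞`. -/
noncomputable def radialLp (p : ℝ≥0∞) (f : ℂ → ℂ) (θ : ℝ) : ℝ≥0∞ :=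
  if p = ⊤ then
    ⨆ r : Set.Ico (0 : ℝ) 1,
      ENNReal.ofReal ‖f ((r : ℝ) * Complex.exp ((θ : ℂ) * Complex.I))‖
  else
    (∫⁻ r in Set.Ioo (0:ℝ) 1,
        ENNReal.ofReal
          (‖f ((r : ℝ) * Complex.exp ((θ : ℂ) * Complex.I))‖ ^ p.toReal)) ^ (1 / p.toReal)

/-- The mixed norm `ρ_{p,q}(f)`, valued in `ℝ≥0∞`; for `q < ∞` it is
`((1/2π) ∫₀^{2π} (radial L^p average)^q dθ)^{1/q}`, and for `q = ∞` the essential/radial sup. -/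
noncomputable def rhoE (p q : ℝ≥0∞) (f : ℂ → ℂ) : ℝ≥0∞ :=
  if q = ⊤ then ⨆ θ : Set.Ico (0 : ℝ) (2 * Real.pi), radialLp p f (θ : ℝ)
  else
    ((ENNReal.ofReal (2 * Real.pi))⁻¹ *
        ∫⁻ θ in Set.Ioo (0 : ℝ) (2 * Real.pi), (radialLp p f θ) ^ q.toReal) ^ (1 / q.toReal)

section aux
open Set Filter Topology Metric

lemma norm_reflect (ζ w : ℂ) (r : ℝ) (hζ : ‖ζ‖ = 1) (hw : ‖w‖ = 1) :
    ‖(r:ℂ) * w - ζ‖ = ‖w - r * ζ‖ := by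
  have h1 : ζ.re ^ 2 + ζ.im ^ 2 = 1 := by
    have := Complex.sq_norm ζ
    rw [hζ, Complex.normSq_apply] at this; linarith
  have h2 : w.re ^ 2 + w.im ^ 2 = 1 := by
    have := Complex.sq_norm w
    rw [hw, Complex.normSq_apply] at this; linarith
  rw [← sq_eq_sq₀ (norm_nonneg _) (norm_nonneg _), Complex.sq_norm, Complex.sq_norm,
    Complex.normSq_apply, Complex.normSq_apply]
  simp
  linear_combination (r^2 - 1) * h2 + (1 - r^2) * h1

lemma dist_pos_aux (ζ w : ℂ) (r : ℝ) (h0 : 0 < r) (_h1 : r < 1) (hζ : ‖ζ‖ = 1) (hw : ‖w‖ = 1) :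
    1 - r ≤ ‖w - r * ζ‖ := by
  have := norm_sub_norm_le w (r * ζ)
  simp [hw, hζ, abs_of_pos h0] at this
  linarith

lemma kernel_bound (ζ w : ℂ) (r : ℝ) (h0 : 0 < r) (h1 : r < 1) (hζ : ‖ζ‖ = 1) (hw : ‖w‖ = 1) :
    ‖((w - r * ζ)^2)⁻¹ - ((w - ζ / r)^2)⁻¹‖ ≤ 2 * (1 - r^2) / ‖w - r * ζ‖^3 := by
  have hd := dist_pos_aux ζ w r h0 h1 hζ hw
  have hdp : 0 < ‖w - r * ζ‖ := by linarith
  have hr : (r : ℂ) ≠ 0 := by exact_mod_cast h0.ne'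
  have hA : w - r * ζ ≠ 0 := norm_pos_iff.1 hdp
  have e1 : w - ζ / r = (r * w - ζ) / r := by field_simp
  have hB : (r:ℂ) * w - ζ ≠ 0 := by
    rw [← norm_pos_iff, norm_reflect ζ w r hζ hw]; exact hdp
  have e2 : ((w - r * ζ)^2)⁻¹ - ((w - ζ / r)^2)⁻¹
      = -((1 - r^2 : ℝ) : ℂ) * ζ * ((r * w - ζ) + r * (w - r * ζ)) /
        ((w - r * ζ)^2 * (r * w - ζ)^2) := by
    rw [e1]
    have hB' : (r:ℂ) * w - ζ ≠ 0 := hB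
    generalize hAA : w - r * ζ = A at *
    generalize hBB : (r:ℂ) * w - ζ = B at *
    have e4 : B ^ 2 - r ^ 2 * A ^ 2 = -((1 - r^2 : ℝ) : ℂ) * ζ * (B + r * A) := by
      rw [← hAA, ← hBB]; push_cast; ring
    rw [← e4]
    field_simp
  rw [e2, norm_div, norm_mul, norm_mul, norm_mul, norm_pow, norm_pow, norm_reflect ζ w r hζ hw, hζ,
    norm_neg, Complex.norm_real, Real.norm_of_nonneg (by nlinarith)]
  have e3 : ‖((r:ℂ) * w - ζ) + r * (w - r * ζ)‖ ≤ 2 * ‖w - r * ζ‖ := by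
    refine (norm_add_le _ _).trans ?_
    rw [norm_reflect ζ w r hζ hw, norm_mul, Complex.norm_real, Real.norm_of_nonneg h0.le]
    nlinarith
  rw [div_le_div_iff₀ (by positivity) (by positivity)]
  have : 0 ≤ 1 - r^2 := by nlinarith
  calc _ ≤ (1 - r^2) * 1 * (2 * ‖w - r * ζ‖) * ‖w - r * ζ‖^3 := by gcongr
    _ = _ := by ring

lemma poisson_int (ζ : ℂ) (r : ℝ) (h0 : 0 < r) (h1 : r < 1) (hζ : ‖ζ‖ = 1) :
    ∫ θ in (0:ℝ)..2 * π, (1 - r^2) / ‖circleMap 0 1 θ - r * ζ‖^2 = 2 * π := by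
  have h := DiffContOnCl.circleAverage_poissonKernel_smul' (E := ℂ) (f := fun _ => (1:ℂ)) (c := 0)
    (R := 1) (w := r * ζ) diffContOnCl_const (by simp [hζ, abs_of_pos h0, h1])
  rw [Real.circleAverage_def] at h
  simp only [sub_zero, norm_mul, hζ, Complex.norm_real, norm_circleMap_zero, abs_one, mul_one,
    Real.norm_of_nonneg h0.le, Complex.real_smul, one_pow] at h
  rw [intervalIntegral.integral_ofReal] at h
  have h' := congrArg Complex.re h
  rw [← Complex.ofReal_mul, Complex.ofReal_re, Complex.one_re] at h'
  have hpi := Real.pi_pos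
  field_simp at h'
  linarith

lemma deriv_est (g : ℂ → ℂ) (hg : DifferentiableOn ℂ g (ball 0 1)) (ζ : ℂ) (r s : ℝ) (h0 : 0 < r)
    (h1 : r < 1) (hs0 : 0 < s) (hs1 : s < 1) (hζ : ‖ζ‖ = 1) :
    ‖(s:ℂ) * deriv g (s * (r * ζ))‖ ≤ (2 * π)⁻¹ * ∫ θ in (0:ℝ)..2 * π,
      2 * (1 - r^2) / ‖circleMap 0 1 θ - r * ζ‖^3 * ‖g (s * circleMap 0 1 θ)‖ := by
  have hsub : closedBall (0:ℂ) 1 ⊆ ball 0 (1/s) := by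
    apply closedBall_subset_ball; rw [lt_div_iff₀ hs0]; linarith
  have hmap : ∀ w ∈ ball (0:ℂ) (1/s), (s:ℂ) * w ∈ ball (0:ℂ) 1 := by
    intro w hw
    rw [mem_ball_zero_iff] at hw ⊢
    rw [norm_mul, Complex.norm_real, Real.norm_of_nonneg hs0.le]
    rw [lt_div_iff₀ hs0] at hw
    linarith
  have hgs : DifferentiableOn ℂ (fun w => g (s * w)) (ball 0 (1/s)) :=
    hg.comp (by fun_prop) hmap
  have hz : (r:ℂ) * ζ ∈ ball (0:ℂ) 1 := by simp [hζ, abs_of_pos h0, h1]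
  have c1 := Complex.two_pi_I_inv_smul_circleIntegral_sub_sq_inv_smul_of_differentiable isOpen_ball
    hsub hgs hz
  have hder : deriv (fun w => g (s * w)) (r * ζ) = s * deriv g (s * (r * ζ)) := by
    have := deriv_comp_mul_left (s:ℂ) g (r * ζ)
    simpa using this
  have hnz : ∀ w ∈ closedBall (0:ℂ) 1, w - ζ / r ≠ 0 := by
    intro w hw h
    rw [sub_eq_zero] at h
    rw [h] at hw
    simp [hζ, abs_of_pos h0] at hw
    have := one_lt_inv₀ h0 |>.2 h1
    linarith
  have hd2 : DifferentiableOn ℂ (fun w => ((w - ζ/r)^2)⁻¹ • g (s * w)) (closedBall 0 1) := by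
    refine DifferentiableOn.fun_smul ?_ (hgs.mono hsub)
    apply DifferentiableOn.inv (by fun_prop)
    intro w hw
    exact pow_ne_zero _ (hnz w hw)
  have c2 : (∮ w in C(0, 1), ((w - ζ/r)^2)⁻¹ • g (s * w)) = 0 :=
    Complex.circleIntegral_eq_zero_of_differentiable_on_off_countable zero_le_one countable_empty
      hd2.continuousOn (fun w hw => (hd2.differentiableAt
        (mem_of_superset (isOpen_ball.mem_nhds hw.1) ball_subset_closedBall)))
  have hgc : ContinuousOn (fun w => g (s * w)) (sphere 0 1) :=
    (hgs.continuousOn.mono (sphere_subset_closedBall.trans hsub))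
  have hnz1 : ∀ w ∈ sphere (0:ℂ) 1, w - r * ζ ≠ 0 := by
    intro w hw
    have := dist_pos_aux ζ w r h0 h1 hζ (by simpa using hw)
    rw [← norm_pos_iff]; linarith
  have hci1 : CircleIntegrable (fun w => ((w - r * ζ)^2)⁻¹ • g (s * w)) 0 1 := by
    apply ContinuousOn.circleIntegrable zero_le_one
    refine ContinuousOn.fun_smul ?_ hgc
    apply ContinuousOn.inv₀ (by fun_prop)
    intro w hw; exact pow_ne_zero _ (hnz1 w hw)
  have hci2 : CircleIntegrable (fun w => ((w - ζ/r)^2)⁻¹ • g (s * w)) 0 1 := by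
    apply ContinuousOn.circleIntegrable zero_le_one
    exact hd2.continuousOn.mono sphere_subset_closedBall
  have c3 := circleIntegral.integral_sub hci1 hci2
  rw [c2, sub_zero] at c3
  rw [← hder, ← c1, ← c3, norm_smul]
  have e : ‖(2 * (π:ℂ) * I)⁻¹‖ = (2 * π)⁻¹ := by simp [abs_of_pos Real.pi_pos]
  rw [e]
  gcongr
  rw [circleIntegral]
  refine (intervalIntegral.norm_integral_le_integral_norm (by positivity)).trans ?_
  apply intervalIntegral.integral_mono_on (by positivity)
  · apply Continuous.intervalIntegrable
    apply Continuous.norm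
    refine Continuous.fun_smul ?_ ?_
    · have e5 : deriv (circleMap 0 1) = fun θ => circleMap 0 1 θ * I := by
        ext θ; exact deriv_circleMap _ _ _
      rw [e5]; fun_prop
    · have := ((hci1.sub hci2))
      have hc : ContinuousOn (fun w => ((w - r * ζ)^2)⁻¹ • g (s * w) - ((w - ζ/r)^2)⁻¹ • g (s * w))
        (sphere 0 1) := by
        apply ContinuousOn.sub _ (hd2.continuousOn.mono sphere_subset_closedBall)
        refine ContinuousOn.fun_smul ?_ hgc
        apply ContinuousOn.inv₀ (by fun_prop)
        intro w hw; exact pow_ne_zero _ (hnz1 w hw)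
      exact hc.comp_continuous (continuous_circleMap 0 1) (fun θ => circleMap_mem_sphere _ zero_le_one _)
  · apply Continuous.intervalIntegrable
    apply Continuous.mul
    · apply Continuous.div (by fun_prop) (by fun_prop)
      intro θ
      exact pow_ne_zero _ (norm_ne_zero_iff.2 (hnz1 _ (circleMap_mem_sphere _ zero_le_one _)))
    · exact (hgc.comp_continuous (continuous_circleMap 0 1)
        (fun θ => circleMap_mem_sphere _ zero_le_one _)).norm
  · intro θ _
    rw [norm_smul, deriv_circleMap, ← sub_smul, norm_smul]
    simp only [norm_mul, norm_circleMap_zero, abs_one, Complex.norm_I, one_mul]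
    gcongr
    exact kernel_bound ζ _ r h0 h1 hζ (by simp)

lemma deriv_est_lim (g : ℂ → ℂ) (hg : DifferentiableOn ℂ g (ball 0 1)) (ζ : ℂ) (r : ℝ) (h0 : 0 < r)
    (h1 : r < 1) (hζ : ‖ζ‖ = 1) (M : ℝ) (hM : ∀ z ∈ ball (0:ℂ) 1, ‖g z‖ ≤ M) (N : ℝ → ℂ)
    (hN : ∀ᵐ θ ∂(volume.restrict (Ioc 0 (2 * π))),
      Tendsto (fun s : ℝ => g (s * circleMap 0 1 θ)) (𝓝[<] 1) (𝓝 (N θ))) :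
    ‖deriv g (r * ζ)‖ ≤ (2 * π)⁻¹ * ∫ θ in (0:ℝ)..2 * π,
      2 * (1 - r^2) / ‖circleMap 0 1 θ - r * ζ‖^3 * ‖N θ‖ := by
  have hev : ∀ᶠ s : ℝ in 𝓝[<] 1, s ∈ Ioo (0:ℝ) 1 := Ioo_mem_nhdsLT zero_lt_one
  have hnz1 : ∀ θ, ‖circleMap 0 1 θ - r * ζ‖ ≠ 0 := by
    intro θ
    have := dist_pos_aux ζ (circleMap 0 1 θ) r h0 h1 hζ (by simp)
    linarith
  have hkc : Continuous fun θ => 2 * (1 - r^2) / ‖circleMap 0 1 θ - r * ζ‖^3 := by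
    apply Continuous.div (by fun_prop) (by fun_prop)
    intro θ
    exact pow_ne_zero _ (hnz1 θ)
  have hz : (r:ℂ) * ζ ∈ ball (0:ℂ) 1 := by simp [hζ, abs_of_pos h0, h1]
  have hδ : 0 ≤ 1 - r^2 := by nlinarith
  refine le_of_tendsto_of_tendsto (b := 𝓝[<] (1:ℝ))
    (f := fun s : ℝ => ‖(s:ℂ) * deriv g (s * (r * ζ))‖)
    (g := fun s : ℝ => (2 * π)⁻¹ * ∫ θ in (0:ℝ)..2 * π,
      2 * (1 - r^2) / ‖circleMap 0 1 θ - r * ζ‖^3 * ‖g (s * circleMap 0 1 θ)‖) ?_ ?_ ?_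
  · have hdc : ContinuousAt (deriv g) (r * ζ) :=
      ((hg.deriv isOpen_ball).continuousOn.continuousAt (isOpen_ball.mem_nhds hz))
    have : ContinuousAt (fun s : ℝ => ‖(s:ℂ) * deriv g (s * (r * ζ))‖) 1 := by
      apply ContinuousAt.norm
      apply ContinuousAt.mul (by fun_prop)
      apply ContinuousAt.comp (g := deriv g) (f := fun s : ℝ => (s:ℂ) * (r * ζ))
      · simpa using hdc
      · fun_prop
    have h := this.tendsto.mono_left (nhdsWithin_le_nhds (s := Iio 1))
    simpa using h
  · apply Filter.Tendsto.const_mul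
    apply intervalIntegral.tendsto_integral_filter_of_dominated_convergence
      (bound := fun θ => 2 * (1 - r^2) / ‖circleMap 0 1 θ - r * ζ‖^3 * M)
    · filter_upwards [hev] with s hs
      apply Continuous.aestronglyMeasurable
      apply hkc.mul
      apply Continuous.norm
      apply hg.continuousOn.comp_continuous (by fun_prop)
      intro θ
      simp [abs_of_pos hs.1, hs.2]
    · filter_upwards [hev] with s hs
      refine Eventually.of_forall fun θ _ => ?_
      rw [norm_mul, norm_norm, Real.norm_of_nonneg (by positivity)]
      gcongr
      apply hM
      simp [abs_of_pos hs.1, hs.2]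
    · exact (hkc.mul continuous_const).intervalIntegrable _ _
    · rw [uIoc_of_le (by positivity)]
      rw [ae_restrict_iff' measurableSet_Ioc] at hN
      filter_upwards [hN] with θ h hθ
      exact ((h hθ).norm).const_mul _
  · filter_upwards [hev] with s hs
    exact deriv_est g hg ζ r s h0 h1 hs.1 hs.2 hζ

lemma deriv_est_fin (g : ℂ → ℂ) (hg : DifferentiableOn ℂ g (ball 0 1)) (ζ : ℂ) (r : ℝ) (h0 : 0 < r)
    (h1 : r < 1) (hζ : ‖ζ‖ = 1) (M : ℝ) (hM : ∀ z ∈ ball (0:ℂ) 1, ‖g z‖ ≤ M) (N : ℝ → ℂ)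
    (hN : ∀ᵐ θ ∂(volume.restrict (Ioc 0 (2 * π))),
      Tendsto (fun s : ℝ => g (s * circleMap 0 1 θ)) (𝓝[<] 1) (𝓝 (N θ)))
    (ε B : ℝ) (hε : 0 < ε) (hB : 0 ≤ B)
    (hNb : ∀ᵐ θ ∂(volume.restrict (Ioc 0 (2 * π))),
      ‖N θ‖ ≤ ε * ‖circleMap 0 1 θ - ζ‖ + B * ‖circleMap 0 1 θ - ζ‖^2) :
    ‖deriv g (r * ζ)‖ ≤ 12 * ε + 2 * B^2 * (1 - r^2) / ε := by
  refine (deriv_est_lim g hg ζ r h0 h1 hζ M hM N hN).trans ?_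
  have hδ : 0 ≤ 1 - r^2 := by nlinarith
  have hd : ∀ θ, 1 - r ≤ ‖circleMap 0 1 θ - r * ζ‖ := fun θ =>
    dist_pos_aux ζ (circleMap 0 1 θ) r h0 h1 hζ (by simp)
  have hc : Continuous fun θ => (1 - r^2) / ‖circleMap 0 1 θ - r * ζ‖^2 := by
    apply Continuous.div (by fun_prop) (by fun_prop)
    intro θ
    have := hd θ
    exact pow_ne_zero _ (by linarith)
  have key : ∫ θ in (0:ℝ)..2 * π, 2 * (1 - r^2) / ‖circleMap 0 1 θ - r * ζ‖^3 * ‖N θ‖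
      ≤ ∫ θ in (0:ℝ)..2 * π, (12 * ε * ((1 - r^2) / ‖circleMap 0 1 θ - r * ζ‖^2)
        + 2 * B^2 * (1 - r^2) / ε) := by
    rw [intervalIntegral.integral_of_le (by positivity),
      intervalIntegral.integral_of_le (by positivity)]
    apply integral_mono_of_nonneg
    · exact Eventually.of_forall fun θ => by positivity
    · exact (((hc.const_mul _).add continuous_const).intervalIntegrable 0 (2 * π)).1
    · filter_upwards [hNb] with θ h
      have hd1 := hd θ
      have hD : ‖circleMap 0 1 θ - ζ‖ ≤ 2 * ‖circleMap 0 1 θ - r * ζ‖ := by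
        have e : circleMap 0 1 θ - ζ = (circleMap 0 1 θ - r * ζ) - ((1 - r : ℝ) : ℂ) * ζ := by
          push_cast; ring
        have := norm_sub_le (circleMap 0 1 θ - r * ζ) (((1 - r : ℝ) : ℂ) * ζ)
        rw [← e, norm_mul, hζ, Complex.norm_real, Real.norm_of_nonneg (by linarith)] at this
        linarith
      have hDn := norm_nonneg (circleMap 0 1 θ - ζ)
      have hdp : 0 < ‖circleMap 0 1 θ - r * ζ‖ := by linarith
      generalize ‖circleMap 0 1 θ - r * ζ‖ = d at *
      generalize ‖circleMap 0 1 θ - ζ‖ = D at *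
      have h3 : ‖N θ‖ ≤ ε * (2 * d) + B * (2 * d)^2 := by
        refine h.trans ?_
        gcongr
      calc 2 * (1 - r^2) / d^3 * ‖N θ‖ ≤ 2 * (1 - r^2) / d^3 * (ε * (2 * d) + B * (2 * d)^2) := by
            gcongr
        _ = (1 - r^2) * (4 * ε / d^2 + 8 * B / d) := by field_simp; ring
        _ ≤ (1 - r^2) * (12 * ε / d^2 + 2 * B^2 / ε) := by
            gcongr ?_ * ?_
            have : 12 * ε / d^2 + 2 * B^2 / ε - (4 * ε / d^2 + 8 * B / d)
              = 2 / ε * (2 * ε / d - B)^2 := by field_simp; ring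
            have h4 : 0 ≤ 2 / ε * (2 * ε / d - B)^2 := by positivity
            linarith
        _ = _ := by ring
  have e : ∫ θ in (0:ℝ)..2 * π, (12 * ε * ((1 - r^2) / ‖circleMap 0 1 θ - r * ζ‖^2)
        + 2 * B^2 * (1 - r^2) / ε) = 2 * π * (12 * ε + 2 * B^2 * (1 - r^2) / ε) := by
    rw [intervalIntegral.integral_add ((hc.const_mul _).intervalIntegrable _ _)
      (continuous_const.intervalIntegrable _ _), intervalIntegral.integral_const_mul,
      poisson_int ζ r h0 h1 hζ, intervalIntegral.integral_const]
    simp; ring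
  rw [e] at key
  have hpi := Real.pi_pos
  calc _ ≤ (2 * π)⁻¹ * (2 * π * (12 * ε + 2 * B^2 * (1 - r^2) / ε)) := by gcongr
    _ = _ := by field_simp

lemma away_aux (θ₀ δ : ℝ) (hθ : θ₀ ∈ Ioo 0 (2 * π)) (hδ : 0 < δ) :
    ∃ η > 0, ∀ θ ∈ Ioo 0 (2 * π), δ ≤ |θ - θ₀| → η ≤ ‖circleMap 0 1 θ - circleMap 0 1 θ₀‖ := by
  have hK : IsCompact (Icc 0 (2 * π) ∩ {θ | δ ≤ |θ - θ₀|}) :=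
    isCompact_Icc.inter_right (isClosed_le continuous_const (by fun_prop))
  rcases (Icc 0 (2 * π) ∩ {θ | δ ≤ |θ - θ₀|}).eq_empty_or_nonempty with h | h
  · refine ⟨1, one_pos, fun θ h1 h2 => ?_⟩
    have : θ ∈ (∅ : Set ℝ) := h ▸ ⟨⟨h1.1.le, h1.2.le⟩, h2⟩
    exact this.elim
  · obtain ⟨x, hx, hmin⟩ := hK.exists_isMinOn h
      (f := fun θ => ‖circleMap 0 1 θ - circleMap 0 1 θ₀‖) (by fun_prop)
    refine ⟨_, ?_, fun θ h1 h2 => hmin ⟨⟨h1.1.le, h1.2.le⟩, h2⟩⟩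
    rw [gt_iff_lt, norm_pos_iff, sub_ne_zero]
    intro heq
    simp only [circleMap, zero_add, Complex.ofReal_one, one_mul] at heq
    rw [Complex.exp_eq_exp_iff_exists_int] at heq
    obtain ⟨n, hn⟩ := heq
    have h3 : x = θ₀ + n * (2 * π) := by
      have h4 : (x : ℂ) * I = (θ₀ + n * (2 * π)) * I := by rw [hn]; ring
      have h5 := mul_right_cancel₀ Complex.I_ne_zero h4
      exact_mod_cast h5
    have hpi := Real.pi_pos
    obtain ⟨⟨hx0, hx1⟩, hx2⟩ := hx
    have hn1 : n < 1 := by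
      by_contra hc
      have : (1:ℝ) ≤ n := by exact_mod_cast not_lt.1 hc
      have := hθ.1
      nlinarith
    have hn2 : -1 < n := by
      by_contra hc
      have : (n:ℝ) ≤ -1 := by exact_mod_cast not_lt.1 hc
      have := hθ.2
      nlinarith
    have hn0 : n = 0 := by omega
    subst hn0
    have : x - θ₀ = 0 := by rw [h3]; simp
    simp only [Set.mem_ofPred_eq, this, abs_zero] at hx2
    linarith

lemma near_aux (H : ℝ → ℂ) (S : Set ℝ) (hS : S ⊆ Ioo 0 (2 * π)) (θ₀ : ℝ) (h0 : θ₀ ∈ S)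
    (hd : DifferentiableWithinAt ℝ H S θ₀) (M : ℝ) (hM : ∀ θ ∈ S, ‖H θ‖ ≤ M) :
    ∃ c : ℂ, ∀ ε > 0, ∃ B ≥ 0, ∀ θ ∈ S,
      ‖H θ - H θ₀ - c * (circleMap 0 1 θ - circleMap 0 1 θ₀)‖ ≤
        ε * ‖circleMap 0 1 θ - circleMap 0 1 θ₀‖ + B * ‖circleMap 0 1 θ - circleMap 0 1 θ₀‖^2 := by
  set c : ℂ := derivWithin H S θ₀ / (circleMap 0 1 θ₀ * I) with hc
  refine ⟨c, fun ε hε => ?_⟩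
  have hE := hasDerivAt_circleMap 0 1 θ₀
  have hnz : circleMap 0 1 θ₀ * I ≠ 0 := mul_ne_zero (by simp [circleMap]) Complex.I_ne_zero
  have hN : HasDerivWithinAt (fun θ => H θ - H θ₀ - c * (circleMap 0 1 θ - circleMap 0 1 θ₀)) 0 S θ₀ := by
    have h1 := (hd.hasDerivWithinAt.sub_const (H θ₀)).sub
      (((hE.hasDerivWithinAt (s := S)).sub_const (circleMap 0 1 θ₀)).const_mul c)
    convert! h1 using 1
    rw [hc, div_mul_cancel₀ _ hnz, sub_self]
  have o1 := (hasDerivWithinAt_iff_isLittleO.1 hN).def (half_pos hε)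
  have o2 := (hasDerivAt_iff_isLittleO.1 hE).def (half_pos one_pos)
  have ev := (o2.filter_mono nhdsWithin_le_nhds).and o1
  rw [eventually_nhdsWithin_iff, Metric.eventually_nhds_iff] at ev
  obtain ⟨δ, hδ, hev⟩ := ev
  obtain ⟨η, hη, haw⟩ := away_aux θ₀ δ (hS h0) hδ
  have hM0 : 0 ≤ M := (norm_nonneg _).trans (hM _ h0)
  refine ⟨(2 * M + 2 * ‖c‖) / η^2, by positivity, fun θ hθ => ?_⟩
  by_cases hcase : |θ - θ₀| < δ
  · obtain ⟨p1, p2⟩ := hev (by simpa [Real.dist_eq] using hcase) hθ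
    simp only [sub_self, mul_zero, smul_zero, sub_zero] at p2
    have p3 : |θ - θ₀| ≤ 2 * ‖circleMap 0 1 θ - circleMap 0 1 θ₀‖ := by
      have q1 : ‖(θ - θ₀) • (circleMap 0 1 θ₀ * I)‖ = |θ - θ₀| := by
        rw [norm_smul]; simp
      have q2 := norm_sub_norm_le ((θ - θ₀) • (circleMap 0 1 θ₀ * I))
        (circleMap 0 1 θ - circleMap 0 1 θ₀)
      rw [norm_sub_rev ((θ - θ₀) • (circleMap 0 1 θ₀ * I)), q1] at q2
      rw [Real.norm_eq_abs] at p1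
      linarith
    rw [Real.norm_eq_abs] at p2
    have : ε / 2 * |θ - θ₀| ≤ ε * ‖circleMap 0 1 θ - circleMap 0 1 θ₀‖ := by nlinarith
    have h5 : 0 ≤ (2 * M + 2 * ‖c‖) / η^2 * ‖circleMap 0 1 θ - circleMap 0 1 θ₀‖^2 := by positivity
    linarith
  · have h6 := haw θ (hS hθ) (not_lt.1 hcase)
    have h7 : ‖H θ - H θ₀ - c * (circleMap 0 1 θ - circleMap 0 1 θ₀)‖ ≤ 2 * M + 2 * ‖c‖ := by
      refine (norm_sub_le _ _).trans ?_
      have := norm_sub_le (H θ) (H θ₀)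
      have := hM θ hθ
      have := hM θ₀ h0
      have h8 : ‖circleMap 0 1 θ - circleMap 0 1 θ₀‖ ≤ 2 := by
        refine (norm_sub_le _ _).trans ?_
        simp; norm_num
      rw [norm_mul]
      nlinarith [norm_nonneg c]
    have h9 : 2 * M + 2 * ‖c‖ ≤ (2 * M + 2 * ‖c‖) / η^2 * ‖circleMap 0 1 θ - circleMap 0 1 θ₀‖^2 := by
      rw [div_mul_eq_mul_div, le_div_iff₀ (by positivity)]
      gcongr
    have : 0 ≤ ε * ‖circleMap 0 1 θ - circleMap 0 1 θ₀‖ := by positivity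
    linarith

lemma bv_aux (H : ℝ → ℂ) (Φ : ℝ → ℝ) (S : Set ℝ) (hΦ : MonotoneOn Φ S)
    (h : ∀ x ∈ S, ∀ y ∈ S, x ≤ y → ‖H y - H x‖ ≤ Φ y - Φ x) : LocallyBoundedVariationOn H S := by
  intro a b ha hb
  have h1 := hΦ.locallyBoundedVariationOn a b ha hb
  refine ne_top_of_le_ne_top h1 ?_
  apply iSup_mono
  rintro ⟨n, u, hu, hus⟩
  apply Finset.sum_le_sum
  intro i _
  have h2 := h _ (hus i).1 _ (hus (i+1)).1 (hu (Nat.le_succ i))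
  rw [edist_dist, edist_dist, dist_eq_norm, Real.dist_eq]
  exact ENNReal.ofReal_le_ofReal (h2.trans (le_abs_self _))

/-- Theorem of Fatou on radial limits. -/
lemma fatou_aux (f : ℂ → ℂ) (hf : DifferentiableOn ℂ f (ball 0 1)) (G : ℝ → ℝ)
    (hG : IntegrableOn G (Ioo 0 (2 * π))) (hG0 : ∀ θ, 0 ≤ G θ)
    (S : Set ℝ) (hS : S ⊆ Ioo 0 (2 * π)) (hSae : ∀ᵐ θ ∂(volume.restrict (Ioo 0 (2 * π))), θ ∈ S)
    (hb : ∀ θ ∈ S, ∀ r ∈ Ico (0:ℝ) 1, ‖f (r * circleMap 0 1 θ)‖ ≤ G θ) :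
    ∀ᵐ θ ∂(volume.restrict (Ioo 0 (2 * π))),
      ∃ L, Tendsto (fun r : ℝ => f (r * circleMap 0 1 θ)) (𝓝[<] 1) (𝓝 L) := by
  obtain ⟨h, hh⟩ := hf.isExactOn_ball
  have hmem : ∀ θ : ℝ, ∀ r ∈ Ico (0:ℝ) 1, (r:ℂ) * circleMap 0 1 θ ∈ ball (0:ℂ) 1 := by
    intro θ r hr
    simp [abs_of_nonneg hr.1, hr.2]
  have hev : ∀ᶠ s : ℝ in 𝓝[<] 1, s ∈ Ico (0:ℝ) 1 :=
    mem_of_superset (Ioo_mem_nhdsLT zero_lt_one) Ioo_subset_Ico_self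
  have hrad : ∀ θ ∈ S, ∀ r ∈ Ico (0:ℝ) 1, ∀ s ∈ Ico (0:ℝ) 1,
      ‖h (s * circleMap 0 1 θ) - h (r * circleMap 0 1 θ)‖ ≤ G θ * ‖s - r‖ := by
    intro θ hθ r hr s hs
    refine (convex_Ico 0 1).norm_image_sub_le_of_norm_hasDerivWithin_le
      (f := fun r : ℝ => h (r * circleMap 0 1 θ))
      (f' := fun r : ℝ => f (r * circleMap 0 1 θ) * circleMap 0 1 θ) ?_ ?_ hr hs
    · intro x hx
      have h1 := (hh _ (hmem θ x hx))
      have h2 : HasDerivAt (fun r : ℝ => (r:ℂ) * circleMap 0 1 θ) (circleMap 0 1 θ) x := by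
        simpa using (Complex.ofRealCLM.hasDerivAt (x := x)).mul_const (circleMap 0 1 θ)
      exact (h1.comp x h2).hasDerivWithinAt
    · intro x hx
      rw [norm_mul]
      simpa using hb θ hθ x hx
  have hlim : ∀ θ ∈ S, ∃ L, Tendsto (fun r : ℝ => h (r * circleMap 0 1 θ)) (𝓝[<] 1) (𝓝 L) := by
    intro θ hθ
    apply cauchy_map_iff_exists_tendsto.1
    have hL : LipschitzOnWith (Real.toNNReal (G θ)) (fun r : ℝ => h (r * circleMap 0 1 θ)) (Ico 0 1) := by
      apply LipschitzOnWith.of_dist_le_mul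
      intro x hx y hy
      rw [dist_eq_norm, dist_eq_norm, Real.coe_toNNReal _ (hG0 θ)]
      exact hrad θ hθ y hy x hx
    have hc : Cauchy (𝓝[<] (1:ℝ)) := cauchy_nhds.mono nhdsWithin_le_nhds
    exact hc.map_of_le hL.uniformContinuousOn (le_principal_iff.2 hev)
  choose! H hH using hlim
  have hGi : ∀ a b : ℝ, a ∈ Ioo 0 (2 * π) → b ∈ Ioo 0 (2 * π) → IntervalIntegrable G volume a b := by
    intro a b ha hb
    rw [intervalIntegrable_iff]
    refine hG.mono_set ?_
    intro x hx
    exact ⟨(lt_min ha.1 hb.1).trans hx.1, hx.2.trans_lt (max_lt ha.2 hb.2)⟩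
  have hang : ∀ x ∈ Ioo 0 (2 * π), ∀ y ∈ Ioo 0 (2 * π), x ≤ y → ∀ r ∈ Ico (0:ℝ) 1,
      ‖h (r * circleMap 0 1 y) - h (r * circleMap 0 1 x)‖ ≤ ∫ θ in x..y, G θ := by
    intro x hx y hy hxy r hr
    have hfc : Continuous fun θ => f (r * circleMap 0 1 θ) :=
      hf.continuousOn.comp_continuous (by fun_prop) (fun θ => hmem θ r hr)
    have h1 : ∫ θ in x..y, f (r * circleMap 0 1 θ) * (r * (circleMap 0 1 θ * I)) =
      h (r * circleMap 0 1 y) - h (r * circleMap 0 1 x) := by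
      apply intervalIntegral.integral_eq_sub_of_hasDerivAt
        (f := fun θ => h (r * circleMap 0 1 θ))
      · intro θ _
        exact (hh _ (hmem θ r hr)).comp θ ((hasDerivAt_circleMap 0 1 θ).const_mul (r:ℂ))
      · apply Continuous.intervalIntegrable
        exact hfc.mul (by fun_prop)
    rw [← h1]
    apply intervalIntegral.norm_integral_le_of_norm_le hxy _ (hGi x y hx hy)
    rw [ae_restrict_iff' measurableSet_Ioo] at hSae
    filter_upwards [hSae] with θ hθ hθ2
    have hθS := hθ ⟨hx.1.trans hθ2.1, hθ2.2.trans_lt hy.2⟩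
    rw [norm_mul]
    have h2 := hb θ hθS r hr
    have h3 : ‖(r:ℂ) * (circleMap 0 1 θ * I)‖ ≤ 1 := by
      simp [abs_of_nonneg hr.1, hr.2.le]
    nlinarith [norm_nonneg (f (r * circleMap 0 1 θ)), norm_nonneg ((r:ℂ) * (circleMap 0 1 θ * I))]
  have hpi := Real.pi_pos
  have hangH : ∀ x ∈ S, ∀ y ∈ S, x ≤ y → ‖H y - H x‖ ≤ ∫ θ in x..y, G θ := by
    intro x hx y hy hxy
    refine le_of_tendsto ((hH y hy).sub (hH x hx)).norm ?_
    filter_upwards [hev] with r hr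
    exact hang x (hS hx) y (hS hy) hxy r hr
  have hπm : π ∈ Ioo 0 (2 * π) := ⟨hpi, by linarith⟩
  have hBV : LocallyBoundedVariationOn H S := by
    have hsub : ∀ x ∈ S, ∀ y ∈ S, (∫ θ in π..y, G θ) - ∫ θ in π..x, G θ = ∫ θ in x..y, G θ := by
      intro x hx y hy
      exact intervalIntegral.integral_interval_sub_left (hGi _ _ hπm (hS hy)) (hGi _ _ hπm (hS hx))
    apply bv_aux H (fun x => ∫ θ in π..x, G θ) S
    · intro x hx y hy hxy
      have h1 := hsub x hx y hy
      have : 0 ≤ ∫ θ in x..y, G θ := intervalIntegral.integral_nonneg hxy (fun _ _ => hG0 _)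
      simp only; linarith
    · intro x hx y hy hxy
      rw [hsub x hx y hy]
      exact hangH x hx y hy hxy
  obtain ⟨θ₁, hθ₁⟩ : S.Nonempty := by
    by_contra hne
    rw [not_nonempty_iff_eq_empty] at hne
    subst hne
    simp only [mem_empty_iff_false, Filter.eventually_false_iff_eq_bot, ae_eq_bot,
      Measure.restrict_eq_zero, Real.volume_Ioo, sub_zero, ENNReal.ofReal_eq_zero] at hSae
    linarith
  have hIbd : ∀ x ∈ Ioo 0 (2 * π), ∀ y ∈ Ioo 0 (2 * π), x ≤ y → 
      ∫ θ in x..y, G θ ≤ ∫ θ in Ioo 0 (2 * π), G θ := by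
    intro x hx y hy hxy
    rw [intervalIntegral.integral_of_le hxy]
    apply setIntegral_mono_set hG (Eventually.of_forall hG0)
    apply LE.le.eventuallyLE
    intro t ht
    exact ⟨hx.1.trans ht.1, ht.2.trans_lt hy.2⟩
  set M : ℝ := ‖h 0‖ + G θ₁ + ∫ θ in Ioo 0 (2 * π), G θ with hMdef
  have hhb0 : ∀ θ ∈ Ioo 0 (2 * π), ∀ r ∈ Ico (0:ℝ) 1, ‖h (r * circleMap 0 1 θ)‖ ≤ M := by
    intro θ hθ r hr
    have h1 := hrad θ₁ hθ₁ 0 (by simp) r hr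
    have h2 : ‖h (r * circleMap 0 1 θ) - h (r * circleMap 0 1 θ₁)‖ ≤ ∫ θ in Ioo 0 (2 * π), G θ := by
      rcases le_total θ₁ θ with hle | hle
      · exact (hang _ (hS hθ₁) _ hθ hle r hr).trans (hIbd _ (hS hθ₁) _ hθ hle)
      · rw [norm_sub_rev]
        exact (hang _ hθ _ (hS hθ₁) hle r hr).trans (hIbd _ hθ _ (hS hθ₁) hle)
    have h3 : G θ₁ * ‖r - 0‖ ≤ G θ₁ := by
      rw [sub_zero, Real.norm_of_nonneg hr.1]
      have := hG0 θ₁; nlinarith [hr.2]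
    simp only [Complex.ofReal_zero, zero_mul] at h1
    have e : h (r * circleMap 0 1 θ) = (h (r * circleMap 0 1 θ) - h (r * circleMap 0 1 θ₁))
      + (h (r * circleMap 0 1 θ₁) - h 0) + h 0 := by ring
    rw [e]
    refine (norm_add₃_le).trans ?_
    linarith
  have hhc : ContinuousOn h (ball 0 1) := fun z hz => (hh z hz).continuousAt.continuousWithinAt
  have hhb : ∀ z ∈ ball (0:ℂ) 1, ‖h z‖ ≤ M := by
    intro z hz
    have hzn : ‖z‖ ∈ Ico (0:ℝ) 1 := ⟨norm_nonneg _, by simpa using hz⟩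
    have hall : ∀ θ ∈ Icc 0 (2 * π), ‖h (‖z‖ * circleMap 0 1 θ)‖ ≤ M := by
      rw [← closure_Ioo (by positivity)]
      refine closure_minimal (t := {θ | ‖h (‖z‖ * circleMap 0 1 θ)‖ ≤ M})
        (fun θ hθ => hhb0 θ hθ _ hzn) (isClosed_le ?_ continuous_const)
      exact (hhc.comp_continuous (by fun_prop) (fun θ => hmem θ _ hzn)).norm
    have hex : ∃ θ ∈ Icc 0 (2 * π), z = ‖z‖ * circleMap 0 1 θ := by
      have e1 : (‖z‖:ℂ) * circleMap 0 1 z.arg = z := by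
        simp [circleMap]
      rcases le_total 0 z.arg with h0 | h0
      · exact ⟨z.arg, ⟨h0, by linarith [Complex.arg_le_pi z]⟩, e1.symm⟩
      · refine ⟨z.arg + 2 * π, ⟨by linarith [Complex.neg_pi_lt_arg z], by linarith⟩, ?_⟩
        rw [(periodic_circleMap 0 1)]; exact e1.symm
    obtain ⟨θ, hθ, hz2⟩ := hex
    rw [hz2]; exact hall θ hθ
  have hHb : ∀ θ ∈ S, ‖H θ‖ ≤ M := by
    intro θ hθ
    refine le_of_tendsto (hH θ hθ).norm ?_
    filter_upwards [hev] with r hr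
    exact hhb0 θ (hS hθ) r hr
  have hdiff := ae_restrict_of_ae (s := Ioo 0 (2 * π)) hBV.ae_differentiableWithinAt_of_mem
  filter_upwards [hdiff, hSae] with θ₀ hd hθ₀
  obtain ⟨c, hc⟩ := near_aux H S hS θ₀ hθ₀ (hd hθ₀) M hHb
  refine ⟨c, ?_⟩
  set ζ := circleMap 0 1 θ₀ with hζdef
  have hζ : ‖ζ‖ = 1 := by simp [hζdef]
  set g : ℂ → ℂ := fun z => h z - H θ₀ - c * (z - ζ) with hgdef
  have hgd : ∀ z ∈ ball (0:ℂ) 1, HasDerivAt g (f z - c) z := by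
    intro z hz
    have := ((hh z hz).sub_const (H θ₀)).fun_sub (((hasDerivAt_id' z).sub_const ζ).const_mul c)
    rw [mul_one] at this
    exact this
  have hgdiff : DifferentiableOn ℂ g (ball 0 1) := fun z hz =>
    (hgd z hz).differentiableAt.differentiableWithinAt
  have hgb : ∀ z ∈ ball (0:ℂ) 1, ‖g z‖ ≤ M + ‖H θ₀‖ + ‖c‖ * 2 := by
    intro z hz
    refine (norm_sub_le _ _).trans ?_
    have h1 := norm_sub_le (h z) (H θ₀)
    have h2 := hhb z hz
    have h3 : ‖z - ζ‖ ≤ 2 := by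
      have := norm_sub_le z ζ
      have hz' : ‖z‖ < 1 := by simpa using hz
      linarith
    rw [norm_mul]
    have := mul_le_mul_of_nonneg_left h3 (norm_nonneg c)
    linarith
  have hres : volume.restrict (Ioc 0 (2 * π)) = volume.restrict (Ioo 0 (2 * π)) :=
    (Measure.restrict_congr_set Ioo_ae_eq_Ioc).symm
  have hN : ∀ᵐ θ ∂(volume.restrict (Ioc 0 (2 * π))),
      Tendsto (fun s : ℝ => g (s * circleMap 0 1 θ)) (𝓝[<] 1)
        (𝓝 (H θ - H θ₀ - c * (circleMap 0 1 θ - ζ))) := by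
    rw [hres]
    filter_upwards [hSae] with θ hθ
    apply ((hH θ hθ).sub_const _).sub
    have : ContinuousAt (fun s : ℝ => c * ((s:ℂ) * circleMap 0 1 θ - ζ)) 1 := by fun_prop
    have h := this.tendsto.mono_left (nhdsWithin_le_nhds (s := Iio 1))
    simpa using h
  rw [Metric.tendsto_nhds]
  intro ε hε
  obtain ⟨B, hB, hBb⟩ := hc (ε / 24) (by positivity)
  have hNb : ∀ᵐ θ ∂(volume.restrict (Ioc 0 (2 * π))),
      ‖H θ - H θ₀ - c * (circleMap 0 1 θ - ζ)‖ ≤ ε / 24 * ‖circleMap 0 1 θ - ζ‖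
        + B * ‖circleMap 0 1 θ - ζ‖^2 := by
    rw [hres]
    filter_upwards [hSae] with θ hθ
    exact hBb θ hθ
  have hsmall : ∀ᶠ r : ℝ in 𝓝[<] 1, 12 * (ε / 24) + 2 * B^2 * (1 - r^2) / (ε / 24) < ε := by
    have hcont : ContinuousAt (fun r : ℝ => 12 * (ε / 24) + 2 * B^2 * (1 - r^2) / (ε / 24)) 1 := by
      fun_prop
    have h := hcont.tendsto.mono_left (nhdsWithin_le_nhds (s := Iio 1))
    apply h.eventually_lt_const
    simp; linarith
  filter_upwards [hsmall, (Ioo_mem_nhdsLT zero_lt_one : Ioo (0:ℝ) 1 ∈ 𝓝[<] 1)] with r hr1 hr2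
  have h5 := deriv_est_fin g hgdiff ζ r hr2.1 hr2.2 hζ _ hgb _ hN (ε/24) B (by positivity) hB hNb
  rw [(hgd _ (hmem θ₀ r ⟨hr2.1.le, hr2.2⟩)).deriv] at h5
  rw [dist_eq_norm]
  exact h5.trans_lt hr1

lemma scheffe_aux {μ : Measure ℝ} (B D : ℕ → ℝ → ℝ≥0∞) (D' : ℝ → ℝ≥0∞) (d : ℕ → ℝ≥0∞)
    (hBm : ∀ n, AEMeasurable (B n) μ) (hDm : ∀ n, AEMeasurable (D n) μ)
    (hBD : ∀ n, ∀ᵐ x ∂μ, B n x ≤ D n x)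
    (hB : ∀ᵐ x ∂μ, Tendsto (fun n => B n x) atTop (𝓝 0))
    (hD : ∀ᵐ x ∂μ, Tendsto (fun n => D n x) atTop (𝓝 (D' x)))
    (hfin : ∫⁻ x, D' x ∂μ ≠ ⊤) (hd : ∀ n, ∫⁻ x, D n x ∂μ ≤ d n)
    (hdl : Tendsto d atTop (𝓝 (∫⁻ x, D' x ∂μ))) :
    Tendsto (fun n => ∫⁻ x, B n x ∂μ) atTop (𝓝 0) := by
  set A := ∫⁻ x, D' x ∂μ with hA
  have hF : A ≤ liminf (fun n => ∫⁻ x, (D n x - B n x) ∂μ) atTop := by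
    refine le_trans (le_of_eq ?_) (lintegral_liminf_le' (fun n => (hDm n).sub (hBm n)))
    apply lintegral_congr_ae
    filter_upwards [hB, hD] with x h1 h2
    have h3 : Tendsto (fun n => D n x - B n x) atTop (𝓝 (D' x - 0)) :=
      ENNReal.Tendsto.sub h2 h1 (Or.inr ENNReal.zero_ne_top)
    rw [tsub_zero] at h3
    exact h3.liminf_eq.symm
  rw [ENNReal.tendsto_nhds_zero]
  intro ε hε
  rcases eq_or_ne ε ⊤ with rfl | hεt
  · exact Eventually.of_forall fun _ => le_top
  have hε2 : ε / 2 ≠ 0 := (ENNReal.half_pos hε.ne').ne'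
  have hε2t : ε / 2 ≠ ⊤ := (ENNReal.div_lt_top hεt two_ne_zero).ne
  have e1 : ∀ᶠ n in atTop, A ≤ (∫⁻ x, (D n x - B n x) ∂μ) + ε / 2 := by
    rcases eq_or_ne A 0 with h0 | h0
    · exact Eventually.of_forall fun _ => by rw [h0]; simp
    · have h1 : A - ε / 2 < liminf (fun n => ∫⁻ x, (D n x - B n x) ∂μ) atTop :=
        (ENNReal.sub_lt_self hfin h0 hε2).trans_le hF
      filter_upwards [eventually_lt_of_lt_liminf h1] with n hn
      exact tsub_le_iff_right.1 hn.le
  have e2 : ∀ᶠ n in atTop, d n < A + ε / 2 :=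
    hdl.eventually_lt_const (ENNReal.lt_add_right hfin hε2)
  filter_upwards [e1, e2] with n h1 h2
  have h3 : ∫⁻ x, B n x ∂μ + ∫⁻ x, (D n x - B n x) ∂μ = ∫⁻ x, D n x ∂μ := by
    rw [← lintegral_add_left' (hBm n)]
    apply lintegral_congr_ae
    filter_upwards [hBD n] with x hx
    exact add_tsub_cancel_of_le hx
  have h4 : ∫⁻ x, B n x ∂μ + A ≤ ε + A := by
    calc ∫⁻ x, B n x ∂μ + A ≤ ∫⁻ x, B n x ∂μ + (∫⁻ x, (D n x - B n x) ∂μ + ε / 2) := by gcongr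
      _ = ∫⁻ x, D n x ∂μ + ε / 2 := by rw [← add_assoc, h3]
      _ ≤ (A + ε / 2) + ε / 2 := by gcongr; exact (hd n).trans h2.le
      _ = ε + A := by rw [add_assoc, ENNReal.add_halves, add_comm]
  exact (ENNReal.add_le_add_iff_right hfin).1 h4

lemma mem_ball_aux (θ u : ℝ) (hu : u ∈ Ico (0:ℝ) 1) :
    (u:ℂ) * Complex.exp ((θ : ℂ) * I) ∈ ball (0:ℂ) 1 := by
  simp [Complex.norm_exp_ofReal_mul_I, abs_of_nonneg hu.1, hu.2]

lemma smul_mem_ball_aux (r : ℝ) (hr : r ∈ Ioo (0:ℝ) 1) (z : ℂ) (hz : z ∈ ball (0:ℂ) 1) :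
    (r:ℂ) * z ∈ ball (0:ℂ) 1 := by
  rw [mem_ball_zero_iff] at *
  rw [norm_mul, Complex.norm_real, Real.norm_of_nonneg hr.1.le]
  nlinarith [hr.1, hr.2, norm_nonneg z]

lemma radialLp_fin (p : ℝ≥0∞) (hp : p ≠ ⊤) (f : ℂ → ℂ) (θ : ℝ) :
    radialLp p f θ = (∫⁻ u in Ioo (0:ℝ) 1,
      ‖f ((u : ℝ) * Complex.exp ((θ : ℂ) * I))‖ₑ ^ p.toReal) ^ (1 / p.toReal) := by
  rw [radialLp, if_neg hp]
  congr 1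
  apply lintegral_congr
  intro u
  rw [← ofReal_norm, ENNReal.ofReal_rpow_of_nonneg (norm_nonneg _) ENNReal.toReal_nonneg]

lemma radialLp_top (f : ℂ → ℂ) (θ : ℝ) :
    radialLp ⊤ f θ = ⨆ u : Ico (0:ℝ) 1, ‖f ((u : ℝ) * Complex.exp ((θ : ℂ) * I))‖ₑ := by
  rw [radialLp, if_pos rfl]
  simp only [ofReal_norm]

lemma radialLp_meas (p : ℝ≥0∞) (g : ℂ → ℂ) (hg : ContinuousOn g (ball 0 1)) :
    Measurable (radialLp p g) := by
  classical
  by_cases hp : p = ⊤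
  · subst hp
    have : radialLp ⊤ g = fun θ : ℝ => ⨆ u : Ico (0:ℝ) 1, ‖g ((u : ℝ) * Complex.exp ((θ : ℂ) * I))‖ₑ := by
      ext θ; exact radialLp_top g θ
    rw [this]
    apply LowerSemicontinuous.measurable
    apply lowerSemicontinuous_iSup
    intro u
    apply Continuous.lowerSemicontinuous
    apply Continuous.enorm
    exact hg.comp_continuous (by fun_prop) (fun θ => mem_ball_aux θ u u.2)
  · have hg' : Measurable ((ball (0:ℂ) 1).piecewise g (fun _ => 0)) := by
      apply ContinuousOn.measurable_piecewise hg continuousOn_const measurableSet_ball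
    have : radialLp p g = fun θ : ℝ => (∫⁻ u in Ioo (0:ℝ) 1,
      ‖(ball (0:ℂ) 1).piecewise g (fun _ => 0) ((u : ℝ) * Complex.exp ((θ : ℂ) * I))‖ₑ ^ p.toReal) ^ (1 / p.toReal) := by
      ext θ
      rw [radialLp_fin p hp g θ]
      congr 1
      apply setLIntegral_congr_fun measurableSet_Ioo
      intro u hu
      simp only
      rw [Set.piecewise_eq_of_mem _ _ _ (mem_ball_aux θ u ⟨hu.1.le, hu.2⟩)]
    rw [this]
    apply Measurable.pow_const
    apply Measurable.lintegral_prod_right'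
      (f := fun x : ℝ × ℝ => ‖(ball (0:ℂ) 1).piecewise g (fun _ => 0) ((x.2 : ℝ) * Complex.exp ((x.1 : ℂ) * I))‖ₑ ^ p.toReal)
    apply Measurable.pow_const
    apply Measurable.enorm
    apply hg'.comp
    fun_prop

lemma scaling_aux (F : ℝ → ℝ≥0∞) (r : ℝ) (hr : r ∈ Ioo (0:ℝ) 1) :
    ∫⁻ u in Ioo (0:ℝ) 1, F (r * u) ≤ ENNReal.ofReal r⁻¹ * ∫⁻ u in Ioo (0:ℝ) 1, F u := by
  have h := lintegral_image_eq_lintegral_abs_deriv_mul (s := Ioo (0:ℝ) 1) (f := fun u => r * u)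
    (f' := fun _ => r) measurableSet_Ioo
    (fun x _ => by simpa using ((hasDerivAt_id x).const_mul r).hasDerivWithinAt)
    (fun x _ y _ h => mul_left_cancel₀ hr.1.ne' h) F
  have hsub : (fun u => r * u) '' Ioo (0:ℝ) 1 ⊆ Ioo (0:ℝ) 1 := by
    rintro _ ⟨u, hu, rfl⟩
    exact ⟨mul_pos hr.1 hu.1, by nlinarith [hr.1, hr.2, hu.1, hu.2]⟩
  have h2 := lintegral_mono_set (μ := volume) (f := F) hsub
  rw [h, lintegral_const_mul' _ _ ENNReal.ofReal_ne_top, abs_of_pos hr.1] at h2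
  calc ∫⁻ u in Ioo (0:ℝ) 1, F (r * u)
      = ENNReal.ofReal r⁻¹ * (ENNReal.ofReal r * ∫⁻ u in Ioo (0:ℝ) 1, F (r * u)) := by
        rw [← mul_assoc, ← ENNReal.ofReal_mul (by have := hr.1; positivity),
          inv_mul_cancel₀ hr.1.ne', ENNReal.ofReal_one, one_mul]
    _ ≤ _ := by gcongr

lemma convex_aux (a b : ℂ) (P : ℝ) (hP : 1 ≤ P) :
    ‖a - b‖ₑ ^ P ≤ (2:ℝ≥0∞) ^ (P - 1) * (‖a‖ₑ ^ P + ‖b‖ₑ ^ P) := by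
  refine le_trans ?_ (ENNReal.rpow_add_le_mul_rpow_add_rpow _ _ hP)
  gcongr
  exact enorm_sub_le


lemma ray_cont (f : ℂ → ℂ) (hf : ContinuousOn f (ball 0 1)) (θ : ℝ) :
    ContinuousOn (fun u : ℝ => f ((u : ℝ) * Complex.exp ((θ : ℂ) * I))) (Ico 0 1) :=
  hf.comp (by fun_prop) (fun u hu => mem_ball_aux θ u hu)

lemma ray_contr (f : ℂ → ℂ) (hf : ContinuousOn f (ball 0 1)) (θ : ℝ) (r : ℝ) (hr : r ∈ Ioo (0:ℝ) 1) :
    ContinuousOn (fun u : ℝ => f ((r : ℂ) * ((u : ℝ) * Complex.exp ((θ : ℂ) * I)))) (Ico 0 1) :=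
  hf.comp (by fun_prop) (fun u hu => smul_mem_ball_aux r hr _ (mem_ball_aux θ u hu))

lemma scaling_f (f : ℂ → ℂ) (θ P : ℝ) (r : ℝ) (hr : r ∈ Ioo (0:ℝ) 1) :
    ∫⁻ u in Ioo (0:ℝ) 1, ‖f ((r : ℂ) * ((u : ℝ) * Complex.exp ((θ : ℂ) * I)))‖ₑ ^ P ≤
    ENNReal.ofReal r⁻¹ * ∫⁻ u in Ioo (0:ℝ) 1, ‖f ((u : ℝ) * Complex.exp ((θ : ℂ) * I))‖ₑ ^ P := by
  have := scaling_aux (fun u => ‖f ((u : ℝ) * Complex.exp ((θ : ℂ) * I))‖ₑ ^ P) r hr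
  simpa only [Complex.ofReal_mul, mul_assoc] using this

lemma ray_meas (f : ℂ → ℂ) (hf : ContinuousOn f (ball 0 1)) (θ P : ℝ) :
    AEMeasurable (fun u : ℝ => ‖f ((u : ℝ) * Complex.exp ((θ : ℂ) * I))‖ₑ ^ P)
      (volume.restrict (Ioo 0 1)) :=
  ((((ray_cont f hf θ).mono Ioo_subset_Ico_self).aemeasurable measurableSet_Ioo).enorm).pow_const _

lemma ray_measr (f : ℂ → ℂ) (hf : ContinuousOn f (ball 0 1)) (θ P r : ℝ) (hr : r ∈ Ioo (0:ℝ) 1) :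
    AEMeasurable (fun u : ℝ => ‖f ((r : ℂ) * ((u : ℝ) * Complex.exp ((θ : ℂ) * I)))‖ₑ ^ P)
      (volume.restrict (Ioo 0 1)) :=
  ((((ray_contr f hf θ r hr).mono Ioo_subset_Ico_self).aemeasurable
    measurableSet_Ioo).enorm).pow_const _

lemma majorant_aux (f : ℂ → ℂ) (hf : ContinuousOn f (ball 0 1)) (θ P : ℝ) (r : ℝ)
    (hr : r ∈ Ioo (0:ℝ) 1) :
    ∫⁻ u in Ioo (0:ℝ) 1, (2:ℝ≥0∞) ^ (P - 1) * (‖f ((u : ℝ) * Complex.exp ((θ : ℂ) * I))‖ₑ ^ P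
      + ‖f ((r : ℂ) * ((u : ℝ) * Complex.exp ((θ : ℂ) * I)))‖ₑ ^ P) ≤
    (2:ℝ≥0∞) ^ (P - 1) * (1 + ENNReal.ofReal r⁻¹) *
      ∫⁻ u in Ioo (0:ℝ) 1, ‖f ((u : ℝ) * Complex.exp ((θ : ℂ) * I))‖ₑ ^ P := by
  rw [lintegral_const_mul'' _ ((ray_meas f hf θ P).fun_add (ray_measr f hf θ P r hr)),
    lintegral_add_left' (ray_meas f hf θ P), mul_assoc, add_mul, one_mul]
  gcongr
  exact scaling_f f θ P r hr

lemma bound_fin (p : ℝ≥0∞) (hp1 : 1 ≤ p) (hp : p ≠ ⊤) (f : ℂ → ℂ) (hf : ContinuousOn f (ball 0 1)) :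
    ∃ C : ℝ≥0∞, C ≠ ⊤ ∧ ∀ r ∈ Ico (1/2:ℝ) 1, ∀ θ,
      radialLp p (fun z => f z - f ((r:ℂ) * z)) θ ≤ C * radialLp p f θ := by
  set P := p.toReal with hPdef
  have hP : 1 ≤ P := by
    have := ENNReal.toReal_mono hp hp1
    simpa using this
  refine ⟨((2:ℝ≥0∞) ^ (P - 1) * 3) ^ (1 / P), ?_, fun r hr θ => ?_⟩
  · apply ENNReal.rpow_ne_top_of_nonneg (by positivity)
    apply ENNReal.mul_ne_top _ (by simp)
    apply ENNReal.rpow_ne_top_of_nonneg (by linarith) (by simp)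
  · have hr' : r ∈ Ioo (0:ℝ) 1 := ⟨by linarith [hr.1], hr.2⟩
    rw [radialLp_fin p hp, radialLp_fin p hp, ← ENNReal.mul_rpow_of_nonneg _ _ (by positivity)]
    gcongr
    refine (lintegral_mono (fun u => convex_aux _ _ P hP)).trans ?_
    refine (majorant_aux f hf θ P r hr').trans ?_
    gcongr
    have : ENNReal.ofReal r⁻¹ ≤ 2 := by
      rw [show (2:ℝ≥0∞) = ENNReal.ofReal 2 by simp]
      apply ENNReal.ofReal_le_ofReal
      rw [inv_le_comm₀ hr'.1 two_pos]
      linarith [hr.1]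
    calc (1:ℝ≥0∞) + ENNReal.ofReal r⁻¹ ≤ 1 + 2 := by gcongr
      _ = 3 := by norm_num

lemma bound_top (f : ℂ → ℂ) (r : ℝ) (hr : r ∈ Ioo (0:ℝ) 1) (θ : ℝ) :
    radialLp ⊤ (fun z => f z - f ((r:ℂ) * z)) θ ≤ 2 * radialLp ⊤ f θ := by
  rw [radialLp_top, radialLp_top, two_mul]
  apply iSup_le
  intro u
  refine enorm_sub_le.trans ?_
  gcongr
  · exact le_iSup (fun u : Ico (0:ℝ) 1 => ‖f ((u : ℝ) * Complex.exp ((θ : ℂ) * I))‖ₑ) u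
  · have hm : r * (u:ℝ) ∈ Ico (0:ℝ) 1 :=
      ⟨mul_nonneg hr.1.le u.2.1, by nlinarith [hr.1, hr.2, u.2.1, u.2.2]⟩
    have := le_iSup (fun u : Ico (0:ℝ) 1 => ‖f ((u : ℝ) * Complex.exp ((θ : ℂ) * I))‖ₑ) ⟨_, hm⟩
    simpa [mul_assoc] using this

lemma conv_fin (p : ℝ≥0∞) (hp1 : 1 ≤ p) (hp : p ≠ ⊤) (f : ℂ → ℂ) (hf : ContinuousOn f (ball 0 1))
    (θ : ℝ) (hfin : radialLp p f θ ≠ ⊤) (r : ℕ → ℝ) (hr : ∀ n, r n ∈ Ioo (0:ℝ) 1)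
    (hlim : Tendsto r atTop (𝓝 1)) :
    Tendsto (fun n => radialLp p (fun z => f z - f ((r n:ℂ) * z)) θ) atTop (𝓝 0) := by
  set P := p.toReal with hPdef
  have hP : 1 ≤ P := by
    have := ENNReal.toReal_mono hp hp1
    simpa using this
  have hP0 : 0 < 1 / P := by positivity
  simp only [radialLp_fin p hp]
  rw [radialLp_fin p hp] at hfin
  have hA : ∫⁻ u in Ioo (0:ℝ) 1, ‖f ((u : ℝ) * Complex.exp ((θ : ℂ) * I))‖ₑ ^ P ≠ ⊤ := by
    intro h
    apply hfin
    rw [h, ENNReal.top_rpow_of_pos hP0]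
  have hK : (2:ℝ≥0∞) ^ (P - 1) ≠ ⊤ := ENNReal.rpow_ne_top_of_nonneg (by linarith) (by simp)
  suffices h : Tendsto (fun n => ∫⁻ u in Ioo (0:ℝ) 1,
      ‖f ((u : ℝ) * Complex.exp ((θ : ℂ) * I)) - f ((r n : ℂ) * ((u : ℝ) * Complex.exp ((θ : ℂ) * I)))‖ₑ ^ P)
      atTop (𝓝 0) by
    have h2 := h.ennrpow_const (1 / P)
    rwa [ENNReal.zero_rpow_of_pos hP0] at h2
  have hpt : ∀ u ∈ Ioo (0:ℝ) 1, Tendsto (fun n => f ((r n : ℂ) * ((u : ℝ) * Complex.exp ((θ : ℂ) * I))))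
      atTop (𝓝 (f ((u : ℝ) * Complex.exp ((θ : ℂ) * I)))) := by
    intro u hu
    have h1 : ContinuousAt f ((u : ℝ) * Complex.exp ((θ : ℂ) * I)) :=
      hf.continuousAt (isOpen_ball.mem_nhds (mem_ball_aux θ u ⟨hu.1.le, hu.2⟩))
    have h2 : Tendsto (fun n => (r n : ℂ) * ((u : ℝ) * Complex.exp ((θ : ℂ) * I))) atTop
        (𝓝 ((u : ℝ) * Complex.exp ((θ : ℂ) * I))) := by
      have h3 : Tendsto (fun n => (r n : ℂ)) atTop (𝓝 ((1:ℝ):ℂ)) :=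
        (Complex.continuous_ofReal.tendsto 1).comp hlim
      have := h3.mul_const ((u : ℝ) * Complex.exp ((θ : ℂ) * I))
      simpa using this
    exact h1.tendsto.comp h2
  apply scheffe_aux
    (D := fun n u => (2:ℝ≥0∞) ^ (P - 1) * (‖f ((u : ℝ) * Complex.exp ((θ : ℂ) * I))‖ₑ ^ P
      + ‖f ((r n : ℂ) * ((u : ℝ) * Complex.exp ((θ : ℂ) * I)))‖ₑ ^ P))
    (D' := fun u => (2:ℝ≥0∞) ^ (P - 1) * (‖f ((u : ℝ) * Complex.exp ((θ : ℂ) * I))‖ₑ ^ P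
      + ‖f ((u : ℝ) * Complex.exp ((θ : ℂ) * I))‖ₑ ^ P))
    (d := fun n => (2:ℝ≥0∞) ^ (P - 1) * (1 + ENNReal.ofReal (r n)⁻¹) *
      ∫⁻ u in Ioo (0:ℝ) 1, ‖f ((u : ℝ) * Complex.exp ((θ : ℂ) * I))‖ₑ ^ P)
  · intro n
    exact (((((ray_cont f hf θ).sub (ray_contr f hf θ _ (hr n))).mono
      Ioo_subset_Ico_self).aemeasurable measurableSet_Ioo).enorm).pow_const _
  · intro n
    exact ((ray_meas f hf θ P).add (ray_measr f hf θ P _ (hr n))).const_mul _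
  · intro n
    exact Eventually.of_forall fun u => convex_aux _ _ P hP
  · filter_upwards [ae_restrict_mem measurableSet_Ioo] with u hu
    have h1 := ((hpt u hu).const_sub (f ((u : ℝ) * Complex.exp ((θ : ℂ) * I)))).enorm.ennrpow_const P
    simpa [show 0 < P by linarith] using h1
  · filter_upwards [ae_restrict_mem measurableSet_Ioo] with u hu
    apply ENNReal.Tendsto.const_mul _ (Or.inr hK)
    exact ((hpt u hu).enorm.ennrpow_const P).const_add _
  · rw [lintegral_const_mul'' _ ((ray_meas f hf θ P).fun_add (ray_meas f hf θ P)),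
      lintegral_add_left' (ray_meas f hf θ P)]
    finiteness
  · intro n
    exact majorant_aux f hf θ P (r n) (hr n)
  · rw [lintegral_const_mul'' _ ((ray_meas f hf θ P).fun_add (ray_meas f hf θ P)),
      lintegral_add_left' (ray_meas f hf θ P), ← two_mul, ← mul_assoc]
    apply ENNReal.Tendsto.mul_const _ (Or.inr hA)
    apply ENNReal.Tendsto.const_mul _ (Or.inr hK)
    have h1 : Tendsto (fun n => (r n)⁻¹) atTop (𝓝 1) := by
      simpa using hlim.inv₀ one_ne_zero
    have h2 := (ENNReal.tendsto_ofReal h1).const_add 1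
    rw [ENNReal.ofReal_one, one_add_one_eq_two] at h2
    exact h2

lemma conv_top (f : ℂ → ℂ) (hf : ContinuousOn f (ball 0 1)) (θ : ℝ) (L : ℂ)
    (hL : Tendsto (fun u : ℝ => f (u * Complex.exp ((θ : ℂ) * I))) (𝓝[<] 1) (𝓝 L))
    (r : ℕ → ℝ) (hr : ∀ n, r n ∈ Ioo (0:ℝ) 1) (hlim : Tendsto r atTop (𝓝 1)) :
    Tendsto (fun n => radialLp ⊤ (fun z => f z - f ((r n:ℂ) * z)) θ) atTop (𝓝 0) := by
  set φ : ℝ → ℂ := fun u => if u < 1 then f (u * Complex.exp ((θ : ℂ) * I)) else L with hφ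
  have hcont : ContinuousOn φ (Icc 0 1) := by
    intro u hu
    rcases hu.2.lt_or_eq with h1 | h1
    · have hc := ray_cont f hf θ u ⟨hu.1, h1⟩
      have h2 : ContinuousWithinAt φ (Ico 0 1) u := by
        apply hc.congr
        · intro y hy; simp [hφ, hy.2]
        · simp [hφ, h1]
      apply h2.mono_of_mem_nhdsWithin
      have : Iio (1:ℝ) ∈ 𝓝 u := Iio_mem_nhds h1
      filter_upwards [self_mem_nhdsWithin, mem_nhdsWithin_of_mem_nhds this] with y hy hy2
      exact ⟨hy.1, hy2⟩
    · subst h1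
      have h3 : ContinuousWithinAt φ (Iio 1) 1 := by
        have : φ 1 = L := by simp [hφ]
        rw [ContinuousWithinAt, this]
        refine hL.congr' ?_
        filter_upwards [self_mem_nhdsWithin] with y hy
        have hy' : y < 1 := hy
        simp [hφ, hy']
      have h4 := (continuousWithinAt_insert_self).2 h3
      apply h4.mono
      intro y hy
      rcases hy.2.lt_or_eq with h | h
      · exact Or.inr h
      · exact Or.inl h
  have huc := isCompact_Icc.uniformContinuousOn_of_continuous hcont
  rw [Metric.uniformContinuousOn_iff] at huc
  rw [ENNReal.tendsto_nhds_zero]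
  intro ε hε
  rcases eq_or_ne ε ⊤ with rfl | hεt
  · exact Eventually.of_forall fun _ => le_top
  have hε' : 0 < ε.toReal := ENNReal.toReal_pos hε.ne' hεt
  obtain ⟨δ, hδ, hd⟩ := huc _ hε'
  have hev : ∀ᶠ n in atTop, dist (r n) 1 < δ := (Metric.tendsto_nhds.1 hlim) δ hδ
  filter_upwards [hev] with n hn
  rw [radialLp_top]
  apply iSup_le
  intro u
  have hu := u.2
  have hrn := hr n
  have hm : r n * (u:ℝ) ∈ Ico (0:ℝ) 1 :=
      ⟨mul_nonneg hrn.1.le hu.1, by nlinarith [hrn.1, hrn.2, hu.1, hu.2]⟩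
  have h5 := hd u ⟨hu.1, hu.2.le⟩ _ ⟨hm.1, hm.2.le⟩ (by
    rw [Real.dist_eq] at hn ⊢
    have : (u:ℝ) - r n * u = -((r n - 1) * u) := by ring
    rw [this, abs_neg, abs_mul, abs_of_nonneg hu.1]
    nlinarith [abs_nonneg (r n - 1), hu.2, hu.1])
  simp only [hφ, hu.2, hm.2, if_true] at h5
  rw [dist_eq_norm] at h5
  rw [← ofReal_norm]
  apply ENNReal.ofReal_le_of_le_toReal
  refine le_trans (le_of_eq ?_) h5.le
  simp [mul_assoc]

lemma main_seq (p : ℝ≥0∞) (q : ℝ) (hp : 1 ≤ p) (hq : 1 ≤ q)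
    (f : ℂ → ℂ) (hf : DifferentiableOn ℂ f (ball (0 : ℂ) 1))
    (hI : ∫⁻ θ in Ioo (0:ℝ) (2 * π), (radialLp p f θ) ^ q ≠ ⊤)
    (r : ℕ → ℝ) (hr : ∀ n, r n ∈ Ico (1/2:ℝ) 1) (hlim : Tendsto r atTop (𝓝 1)) :
    Tendsto (fun n => ∫⁻ θ in Ioo (0:ℝ) (2 * π),
      (radialLp p (fun z => f z - f ((r n : ℂ) * z)) θ) ^ q) atTop (𝓝 0) := by
  have hq0 : 0 < q := by linarith
  have hr' : ∀ n, r n ∈ Ioo (0:ℝ) 1 := fun n => ⟨by linarith [(hr n).1], (hr n).2⟩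
  have hc := hf.continuousOn
  have hae : ∀ᵐ θ ∂(volume.restrict (Ioo (0:ℝ) (2 * π))), radialLp p f θ ≠ ⊤ := by
    filter_upwards [ae_lt_top ((radialLp_meas p f hc).pow_const q) hI] with θ h1 h2
    rw [h2, ENNReal.top_rpow_of_pos hq0] at h1
    exact lt_irrefl _ h1
  have hbd : ∃ C : ℝ≥0∞, C ≠ ⊤ ∧ ∀ n, ∀ θ,
      radialLp p (fun z => f z - f ((r n:ℂ) * z)) θ ≤ C * radialLp p f θ := by
    by_cases hpt : p = ⊤
    · subst hpt
      exact ⟨2, by simp, fun n θ => bound_top f (r n) (hr' n) θ⟩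
    · obtain ⟨C, hC, h⟩ := bound_fin p hp hpt f hc
      exact ⟨C, hC, fun n θ => h _ (hr n) θ⟩
  have hpt : ∀ᵐ θ ∂(volume.restrict (Ioo (0:ℝ) (2 * π))),
      Tendsto (fun n => radialLp p (fun z => f z - f ((r n:ℂ) * z)) θ) atTop (𝓝 0) := by
    by_cases hpt : p = ⊤
    · subst hpt
      have hG : IntegrableOn (fun θ => (radialLp ⊤ f θ).toReal) (Ioo (0:ℝ) (2 * π)) := by
        apply integrable_toReal_of_lintegral_ne_top (radialLp_meas ⊤ f hc).aemeasurable
        have h1 : ∫⁻ θ in Ioo (0:ℝ) (2 * π), radialLp ⊤ f θ ≤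
            ∫⁻ θ in Ioo (0:ℝ) (2 * π), (1 + (radialLp ⊤ f θ) ^ q) := by
          apply lintegral_mono
          intro θ
          rcases le_total (radialLp ⊤ f θ) 1 with h | h
          · exact h.trans le_self_add
          · refine le_trans ?_ le_add_self
            have := ENNReal.rpow_le_rpow_of_exponent_le h hq
            simpa using this
        refine ne_top_of_le_ne_top ?_ h1
        rw [lintegral_add_left measurable_const]
        apply ENNReal.add_ne_top.2 ⟨?_, hI⟩
        simp [ENNReal.mul_eq_top]
      have hF := fatou_aux f hf (fun θ => (radialLp ⊤ f θ).toReal) hG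
        (fun θ => ENNReal.toReal_nonneg)
        {θ | θ ∈ Ioo (0:ℝ) (2 * π) ∧ radialLp ⊤ f θ ≠ ⊤} (fun θ h => h.1)
        (by
          filter_upwards [hae, ae_restrict_mem measurableSet_Ioo] with θ h1 h2
          exact ⟨h2, h1⟩)
        (by
          intro θ hθ u hu
          have h1 := le_iSup (fun u : Ico (0:ℝ) 1 =>
            ‖f ((u : ℝ) * Complex.exp ((θ : ℂ) * I))‖ₑ) ⟨u, hu⟩
          rw [← radialLp_top] at h1
          have h2 := ENNReal.toReal_mono hθ.2 h1
          simpa [circleMap] using h2)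
      filter_upwards [hF] with θ hθ
      obtain ⟨L, hL⟩ := hθ
      exact conv_top f hc θ L (by simpa [circleMap] using hL) r hr' hlim
    · filter_upwards [hae] with θ h1
      exact conv_fin p hp hpt f hc θ h1 r hr' hlim
  obtain ⟨C, hC, hbd⟩ := hbd
  have key := tendsto_lintegral_of_dominated_convergence
    (μ := volume.restrict (Ioo (0:ℝ) (2 * π)))
    (F := fun n θ => (radialLp p (fun z => f z - f ((r n : ℂ) * z)) θ) ^ q)
    (f := fun _ => 0)
    (fun θ => C ^ q * (radialLp p f θ) ^ q)
    (fun n => (radialLp_meas p _ (hc.sub (hc.comp (by fun_prop)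
      (fun z hz => smul_mem_ball_aux (r n) (hr' n) z hz)))).pow_const q)
    (fun n => Eventually.of_forall fun θ => by
      beta_reduce
      rw [← ENNReal.mul_rpow_of_nonneg _ _ hq0.le]
      exact ENNReal.rpow_le_rpow (hbd n θ) hq0.le)
    (by
      have hCq : C ^ q ≠ ⊤ := ENNReal.rpow_ne_top_of_nonneg hq0.le hC
      rw [lintegral_const_mul' _ _ hCq]
      exact ENNReal.mul_ne_top hCq hI)
    (by
      filter_upwards [hpt] with θ h
      have h2 := h.ennrpow_const q
      rwa [ENNReal.zero_rpow_of_pos hq0] at h2)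
  simpa using key

end aux

/-- For `1 ≤ p ≤ ∞`, `1 ≤ q < ∞` and `f ∈ RM(p,q)`, one has `ρ_{p,q}(f - f_r) → 0`
as `r → 1⁻`, where `f_r(z) = f(rz)`. -/
theorem stmt_12 (p : ℝ≥0∞) (q : ℝ) (hp : 1 ≤ p) (hq : 1 ≤ q)
    (f : ℂ → ℂ) (hf : DifferentiableOn ℂ f (Metric.ball (0 : ℂ) 1))
    (hfin : rhoE p (ENNReal.ofReal q) f ≠ ⊤) :
    Filter.Tendsto
      (fun r : ℝ => rhoE p (ENNReal.ofReal q) (fun z => f z - f ((r : ℂ) * z)))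
      (nhdsWithin 1 (Set.Iio 1)) (nhds 0) := by
  have hq0 : 0 < q := by linarith
  have hπ : (ENNReal.ofReal (2 * Real.pi))⁻¹ ≠ 0 := ENNReal.inv_ne_zero.2 ENNReal.ofReal_ne_top
  have hπ' : (ENNReal.ofReal (2 * Real.pi))⁻¹ ≠ ⊤ := by
    apply ENNReal.inv_ne_top.2
    simp [Real.pi_pos]
  have hq1 : 0 < 1 / q := by positivity
  have hrho : ∀ g : ℂ → ℂ, rhoE p (ENNReal.ofReal q) g = ((ENNReal.ofReal (2 * Real.pi))⁻¹ *
        ∫⁻ θ in Set.Ioo (0 : ℝ) (2 * Real.pi), (radialLp p g θ) ^ q) ^ (1 / q) := by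
    intro g
    rw [rhoE, if_neg ENNReal.ofReal_ne_top, ENNReal.toReal_ofReal hq0.le]
  have hI : ∫⁻ θ in Set.Ioo (0:ℝ) (2 * Real.pi), (radialLp p f θ) ^ q ≠ ⊤ := by
    intro h
    apply hfin
    rw [hrho, h, ENNReal.mul_top hπ, ENNReal.top_rpow_of_pos hq1]
  simp only [hrho]
  apply Filter.tendsto_of_seq_tendsto
  intro r hr
  rw [tendsto_nhdsWithin_iff] at hr
  obtain ⟨hlim, hlt⟩ := hr
  have hge : ∀ᶠ n in Filter.atTop, (1/2:ℝ) < r n :=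
    hlim.eventually_const_lt (by norm_num)
  obtain ⟨N, hN⟩ := Filter.eventually_atTop.1 (hge.and hlt)
  have hlim' : Filter.Tendsto (fun n => r (n + N)) Filter.atTop (nhds 1) :=
    (Filter.tendsto_add_atTop_iff_nat N).2 hlim
  have key := main_seq p q hp hq f hf hI (fun n => r (n + N))
    (fun n => ⟨(hN (n + N) (by omega)).1.le, (hN (n + N) (by omega)).2⟩) hlim'
  rw [← Filter.tendsto_add_atTop_iff_nat N]
  have h2 := (ENNReal.Tendsto.const_mul (a := (ENNReal.ofReal (2 * Real.pi))⁻¹) key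
    (Or.inr hπ')).ennrpow_const (1 / q)
  rw [mul_zero, ENNReal.zero_rpow_of_pos hq1] at h2
  exact h2
end

section
/- Let 1 ≤ p < ∞ and f ∈ RM(p,∞). Then the nontangential limit of f(z)(1 - z̄σ z)^{1/p} at any boundary point σ ∈ ∂𝔻 is 0; in particular lim_{r→1⁻} |f(r)| (1-r)^{1/p} = 0 when σ = 1. -/
open MeasureTheory Complex Real ENNReal

open Filter Topology Metric Set in
/-- Local Lipschitz estimate for bounded holomorphic functions. -/
lemma aux_lip {F : ℂ → ℂ} {c : ℂ} {ρ B : ℝ} (hd : DifferentiableOn ℂ F (ball c ρ))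
    (hB : ∀ z ∈ ball c ρ, ‖F z‖ ≤ B) {z : ℂ} (hz : z ∈ ball c ρ) :
    dist (F z) (F c) ≤ (2 * B) / ρ * dist z c := by
  refine Complex.dist_le_div_mul_dist_of_mapsTo_ball hd (fun w hw => ?_) hz
  have hc : c ∈ ball c ρ := mem_ball_self (pos_of_mem_ball hz)
  rw [mem_closedBall, dist_eq_norm]
  have := norm_sub_le (F w) (F c)
  linarith [hB w hw, hB c hc]

open Filter Topology Metric Set in
/-- A Vitali-type theorem. -/
lemma aux_vitali {ι : Type*} (l : Filter ι) (F : ι → ℂ → ℂ) (B : ℝ)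
    (hd : ∀ᶠ i in l, DifferentiableOn ℂ (F i) (ball 0 1))
    (hB : ∀ᶠ i in l, ∀ z ∈ ball (0 : ℂ) 1, ‖F i z‖ ≤ B)
    (h0 : ∀ x : ℝ, 0 < x → x < 1 → Tendsto (fun i => F i x) l (𝓝 0))
    (c : ℝ) (hc : c < 1) (w : ι → ℂ) (hw : ∀ᶠ i in l, ‖w i‖ ≤ c) :
    Tendsto (fun i => F i (w i)) l (𝓝 0) := by
  rw [tendsto_iff_ultrafilter]
  intro U hU
  have hd' := hU hd
  have hB' := hU hB
  have hw' := hU hw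
  have hex : ∀ z : ℂ, ∃ y : ℂ, z ∈ ball (0 : ℂ) 1 → Tendsto (fun i => F i z) U (𝓝 y) := by
    intro z
    by_cases hz : z ∈ ball (0 : ℂ) 1
    · obtain ⟨y, _, hy⟩ := (isCompact_closedBall (0 : ℂ) B).ultrafilter_le_nhds
        (U.map (fun i => F i z)) (by
          rw [le_principal_iff]
          show ∀ᶠ i in (U : Filter ι), F i z ∈ closedBall (0 : ℂ) B
          filter_upwards [hB'] with i hi
          simpa using hi z hz)
      exact ⟨y, fun _ => hy⟩
    · exact ⟨0, fun h => absurd h hz⟩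
  choose G hG using hex
  have hloc : TendstoLocallyUniformlyOn F G (U : Filter ι) (ball 0 1) := by
    rw [Metric.tendstoLocallyUniformlyOn_iff]
    intro ε hε x hx
    obtain ⟨ρ, hρ, hsub⟩ : ∃ ρ > 0, ball x ρ ⊆ ball (0 : ℂ) 1 :=
      Metric.isOpen_iff.1 isOpen_ball x hx
    have hlip : ∀ᶠ i in (U : Filter ι), ∀ y ∈ ball x ρ,
        dist (F i y) (F i x) ≤ (2 * B) / ρ * dist y x := by
      filter_upwards [hd', hB'] with i h1 h2 y hy
      exact aux_lip (h1.mono hsub) (fun z hz => h2 z (hsub hz)) hy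
    have hGlip : ∀ y ∈ ball x ρ, dist (G y) (G x) ≤ (2 * B) / ρ * dist y x := by
      intro y hy
      refine le_of_tendsto ((hG y (hsub hy)).dist (hG x hx)) ?_
      filter_upwards [hlip] with i hi using hi y hy
    have hsmall : ∀ᶠ y in 𝓝 x, (2 * B) / ρ * dist y x < ε / 3 := by
      have : Tendsto (fun y => (2 * B) / ρ * dist y x) (𝓝 x) (𝓝 ((2 * B) / ρ * dist x x)) :=
        (continuous_const.mul (continuous_id.dist continuous_const)).tendsto x
      rw [dist_self, mul_zero] at this
      exact this.eventually (gt_mem_nhds (by positivity))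
    refine ⟨{y | y ∈ ball x ρ ∧ (2 * B) / ρ * dist y x < ε / 3}, ?_, ?_⟩
    · exact mem_nhdsWithin_of_mem_nhds (Filter.inter_mem (ball_mem_nhds x hρ) hsmall)
    · filter_upwards [hlip, (Metric.tendsto_nhds.1 (hG x hx)) (ε / 3) (by positivity)]
        with i hi hix y hy
      have h1 := hi y hy.1
      have h2 := hGlip y hy.1
      have h3 := hy.2
      have := dist_triangle4 (G y) (G x) (F i x) (F i y)
      rw [dist_comm (F i y)] at h1
      rw [dist_comm (F i x)] at hix
      linarith
  have hGd : DifferentiableOn ℂ G (ball 0 1) := hloc.differentiableOn hd' isOpen_ball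
  have hGa : AnalyticOnNhd ℂ G (ball 0 1) := hGd.analyticOnNhd isOpen_ball
  have hGr : ∀ x : ℝ, 0 < x → x < 1 → G x = 0 := by
    intro x h1 h2
    have hx : (x : ℂ) ∈ ball (0 : ℂ) 1 := by
      simp [abs_of_pos h1, h2]
    exact tendsto_nhds_unique (hG x hx) ((h0 x h1 h2).mono_left hU)
  have hz : EqOn G 0 (ball 0 1) := by
    refine hGa.eqOn_zero_of_preconnected_of_frequently_eq_zero
      (convex_ball (0 : ℂ) 1).isPreconnected (mem_ball_self one_pos) ?_
    have ht : Tendsto (fun x : ℝ => (x : ℂ)) (𝓝[>] 0) (𝓝[≠] 0) := by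
      refine tendsto_nhdsWithin_iff.2 ⟨?_, ?_⟩
      · exact (Complex.continuous_ofReal.tendsto' 0 0 (by simp)).mono_left nhdsWithin_le_nhds
      · filter_upwards [self_mem_nhdsWithin] with x hx
        simpa using (ne_of_gt hx)
    refine ht.frequently (Eventually.frequently ?_)
    filter_upwards [Ioo_mem_nhdsGT (zero_lt_one' ℝ)] with x hx using hGr x hx.1 hx.2
  -- convergence along `w`
  have hunif := (tendstoLocallyUniformlyOn_iff_forall_isCompact isOpen_ball).1 hloc
    (closedBall 0 c) (closedBall_subset_ball hc) (isCompact_closedBall _ _)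
  rw [Metric.tendstoUniformlyOn_iff] at hunif
  rw [Metric.tendsto_nhds]
  intro ε hε
  filter_upwards [hunif ε hε, hw'] with i hi hwi
  have h1 : w i ∈ closedBall (0 : ℂ) c := by simpa using hwi
  have h2 := hi _ h1
  rw [hz (closedBall_subset_ball hc h1)] at h2
  rw [dist_comm]
  exact h2

open Filter Topology Metric Set in
lemma aux_int (p : ℝ) (hp : 1 ≤ p) (f : ℂ → ℂ)
    (hf : DifferentiableOn ℂ f (Metric.ball (0 : ℂ) 1))
    (hfin : rhoE (ENNReal.ofReal p) ⊤ f ≠ ⊤) :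
    ∃ M : ℝ, 0 ≤ M ∧ ∀ σ : ℂ, ‖σ‖ = 1 →
      IntegrableOn (fun r : ℝ => ‖f (r * σ)‖ ^ p) (Ioo 0 1) ∧
      ∫ r in Ioo (0 : ℝ) 1, ‖f (r * σ)‖ ^ p ≤ M := by
  have hp0 : 0 < p := by linarith
  set A := rhoE (ENNReal.ofReal p) ⊤ f with hA
  refine ⟨(A ^ p).toReal, ENNReal.toReal_nonneg, fun σ hσ => ?_⟩
  obtain ⟨θ, hθ, hσθ⟩ : ∃ θ ∈ Ico (0 : ℝ) (2 * Real.pi),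
      σ = Complex.exp ((θ : ℂ) * Complex.I) := by
    refine ⟨toIcoMod Real.two_pi_pos 0 σ.arg, ?_, ?_⟩
    · simpa using toIcoMod_mem_Ico Real.two_pi_pos 0 σ.arg
    · have h1 : σ = Complex.exp ((σ.arg : ℂ) * Complex.I) := by
        have := Complex.norm_mul_exp_arg_mul_I σ
        rw [hσ] at this
        simpa using this.symm
      rw [h1]
      conv_rhs => rw [← h1]
      rw [toIcoMod, Complex.exp_eq_exp_iff_exists_int]
      refine ⟨toIcoDiv Real.two_pi_pos 0 σ.arg, ?_⟩
      push_cast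
      simp
      ring
  have hle : radialLp (ENNReal.ofReal p) f θ ≤ A := by
    rw [hA, rhoE, if_pos rfl]
    exact le_iSup (fun θ : Set.Ico (0 : ℝ) (2 * Real.pi) =>
      radialLp (ENNReal.ofReal p) f (θ : ℝ)) ⟨θ, hθ⟩
  rw [radialLp, if_neg ENNReal.ofReal_ne_top, ENNReal.toReal_ofReal hp0.le, ← hσθ] at hle
  have hle2 : ∫⁻ r in Ioo (0 : ℝ) 1, ENNReal.ofReal (‖f (r * σ)‖ ^ p) ≤ A ^ p := by
    have := ENNReal.rpow_le_rpow hle hp0.le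
    rwa [← ENNReal.rpow_mul, one_div, inv_mul_cancel₀ hp0.ne', ENNReal.rpow_one] at this
  have hAp : A ^ p ≠ ⊤ := ENNReal.rpow_ne_top_of_nonneg hp0.le hfin
  have hcont : ContinuousOn (fun r : ℝ => ‖f (r * σ)‖ ^ p) (Ioo 0 1) := by
    refine ContinuousOn.rpow_const (ContinuousOn.norm (hf.continuousOn.comp (by fun_prop) ?_))
      (fun _ _ => Or.inr hp0.le)
    intro r hr
    simp [hσ, abs_of_pos hr.1, hr.2]
  have hm : AEStronglyMeasurable (fun r : ℝ => ‖f (r * σ)‖ ^ p) (volume.restrict (Ioo 0 1)) :=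
    hcont.aestronglyMeasurable measurableSet_Ioo
  have hnn : 0 ≤ᵐ[volume.restrict (Ioo (0 : ℝ) 1)] (fun r : ℝ => ‖f (r * σ)‖ ^ p) :=
    Eventually.of_forall fun r => by positivity
  refine ⟨⟨hm, ?_⟩, ?_⟩
  · rw [hasFiniteIntegral_iff_ofReal hnn]
    exact lt_of_le_of_lt hle2 (lt_top_iff_ne_top.2 hAp)
  · rw [integral_eq_lintegral_of_nonneg_ae hnn hm]
    exact ENNReal.toReal_mono hAp hle2

open Filter Topology Metric Set in
lemma aux_step (p : ℝ) (hp : 1 ≤ p) (f : ℂ → ℂ)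
    (hf : DifferentiableOn ℂ f (Metric.ball (0 : ℂ) 1)) (M : ℝ)
    (hM : ∀ σ : ℂ, ‖σ‖ = 1 →
      IntegrableOn (fun r : ℝ => ‖f (r * σ)‖ ^ p) (Ioo 0 1) ∧
      ∫ r in Ioo (0 : ℝ) 1, ‖f (r * σ)‖ ^ p ≤ M) (z : ℂ) (d : ℝ) (hd0 : 0 < d)
    (hd1 : d ≤ 1 / 2) (hz : ‖z‖ = 1 - d) :
    ∃ z' : ℂ, ‖z'‖ = 1 - 2 * d ∧
      ‖f z‖ ≤ ‖f z'‖ + 2 * (2 + M) * d ^ (-(1 / p)) := by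
  have hp0 : 0 < p := by linarith
  obtain ⟨P, hP⟩ := hf.isExactOn_ball
  set k : ℝ := (1 - 2 * d) / (1 - d) with hk
  have hk0 : 0 ≤ k := div_nonneg (by linarith) (by linarith)
  have hk1 : k ≤ 1 := (div_le_one (by linarith)).2 (by linarith)
  have hkd : 1 - k ≤ 2 * d := by
    have : 1 - k = d / (1 - d) := by 
      have : (1 - d) ≠ 0 := by linarith
      rw [hk]; field_simp; ring
    rw [this, div_le_iff₀ (by linarith)]
    nlinarith
  set c : ℝ := d ^ (-(1 / p)) with hc
  have hc0 : 0 < c := Real.rpow_pos_of_pos hd0 _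
  have hcp : c ^ (1 - p) = d * c := by
    rw [hc, ← Real.rpow_mul hd0.le]
    nth_rewrite 2 [← Real.rpow_one d]
    rw [← Real.rpow_add hd0]
    congr 1
    field_simp
    ring
  -- the elementary inequality replacing Hölder
  have hyoung : ∀ x : ℝ, 0 ≤ x → x ≤ c + c ^ (1 - p) * x ^ p := by
    intro x hx
    rcases le_or_gt x c with h | h
    · have : 0 ≤ c ^ (1 - p) * x ^ p := by positivity
      linarith
    · have hx0 : 0 < x := hc0.trans h
      have h1 : x ^ (1 - p) ≤ c ^ (1 - p) :=
        Real.rpow_le_rpow_of_nonpos hc0 h.le (by linarith)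
      have h2 : x = x ^ (1 - p) * x ^ p := by
        rw [← Real.rpow_add hx0]; simp
      have h3 : x ^ (1 - p) * x ^ p ≤ c ^ (1 - p) * x ^ p := by gcongr
      linarith
  have key : ∀ w : ℂ, ‖w‖ < 1 → ‖P w - P (k * w)‖ ≤ (2 + M) * (d * c) := by
    intro w hw
    set σ : ℂ := Complex.exp (w.arg * Complex.I) with hσ
    have hσ1 : ‖σ‖ = 1 := Complex.norm_exp_ofReal_mul_I _
    have hwσ : w = (‖w‖ : ℝ) * σ := (Complex.norm_mul_exp_arg_mul_I w).symm
    obtain ⟨hintg, hle⟩ := hM σ hσ1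
    have hab : k * ‖w‖ ≤ ‖w‖ := mul_le_of_le_one_left (norm_nonneg _) hk1
    have ha : 0 ≤ k * ‖w‖ := by positivity
    have hmem : ∀ t ∈ uIcc (k * ‖w‖) ‖w‖, (t : ℂ) * σ ∈ ball (0 : ℂ) 1 := by
      intro t ht
      rw [uIcc_of_le hab] at ht
      have : |t| < 1 := by rw [abs_of_nonneg (ha.trans ht.1)]; linarith [ht.2]
      simpa [hσ1] using this
    have hder : ∀ t ∈ uIcc (k * ‖w‖) ‖w‖,
        HasDerivAt (fun t : ℝ => P (t * σ)) (f (t * σ) * σ) t := by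
      intro t ht
      have h1 : HasDerivAt (fun t : ℝ => (t : ℂ) * σ) (1 * σ) t :=
        (Complex.ofRealCLM.hasDerivAt (x := t)).mul_const σ
      have h2 := (hP _ (hmem t ht)).comp t h1
      simpa [Function.comp_def] using h2
    have hcf : ContinuousOn (fun t : ℝ => f (t * σ) * σ) (uIcc (k * ‖w‖) ‖w‖) :=
      (hf.continuousOn.comp (by fun_prop) hmem).mul continuousOn_const
    have hI := intervalIntegral.integral_eq_sub_of_hasDerivAt hder hcf.intervalIntegrable
    have e1 : P w - P (k * w) = P ((‖w‖ : ℝ) * σ) - P ((k * ‖w‖ : ℝ) * σ) := by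
      rw [← hwσ]
      congr 2
      conv_lhs => rw [hwσ]
      push_cast; ring
    rw [e1, ← hI]
    have hsub : Ioc (k * ‖w‖) ‖w‖ ⊆ Ioo 0 1 := fun t ht =>
      ⟨lt_of_le_of_lt ha ht.1, lt_of_le_of_lt ht.2 hw⟩
    have hii : IntervalIntegrable (fun r : ℝ => ‖f (r * σ)‖ ^ p) volume (k * ‖w‖) ‖w‖ := by
      rw [intervalIntegrable_iff_integrableOn_Ioc_of_le hab]
      exact hintg.mono_set hsub
    have hle' : ∫ t in (k * ‖w‖)..‖w‖, ‖f (t * σ)‖ ^ p ≤ M := by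
      rw [intervalIntegral.integral_of_le hab]
      refine le_trans (setIntegral_mono_set hintg ?_ hsub.eventuallyLE) hle
      exact Eventually.of_forall fun r => by positivity
    calc ‖∫ t in (k * ‖w‖)..‖w‖, f (t * σ) * σ‖
        ≤ ∫ t in (k * ‖w‖)..‖w‖, (c + c ^ (1 - p) * ‖f (t * σ)‖ ^ p) := by
          refine intervalIntegral.norm_integral_le_of_norm_le hab ?_
            (intervalIntegrable_const.add (hii.const_mul _))
          refine Eventually.of_forall fun t _ => ?_
          rw [norm_mul, hσ1, mul_one]
          exact hyoung _ (norm_nonneg _)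
      _ = (‖w‖ - k * ‖w‖) * c + c ^ (1 - p) * ∫ t in (k * ‖w‖)..‖w‖, ‖f (t * σ)‖ ^ p := by
          rw [intervalIntegral.integral_add intervalIntegrable_const (hii.const_mul _),
            intervalIntegral.integral_const, intervalIntegral.integral_const_mul, smul_eq_mul]
      _ ≤ (2 * d) * c + (d * c) * M := by
          rw [hcp]
          have : ‖w‖ - k * ‖w‖ ≤ 2 * d := by
            nlinarith [norm_nonneg w]
          gcongr
      _ = (2 + M) * (d * c) := by ring
  have hzlt : ‖z‖ < 1 := by linarith
  have hkz : ‖(k : ℂ) * z‖ = 1 - 2 * d := by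
    rw [norm_mul, Complex.norm_real, Real.norm_of_nonneg hk0, hz, hk]
    have : (1 - d) ≠ 0 := by linarith
    field_simp
  refine ⟨k * z, hkz, ?_⟩
  have hDer : ∀ w ∈ ball (0 : ℂ) 1,
      HasDerivAt (fun w => P w - P (k * w)) (f w - f (k * w) * k) w := by
    intro w hw
    have hkw : (k : ℂ) * w ∈ ball (0 : ℂ) 1 := by
      rw [mem_ball_zero_iff] at hw ⊢
      rw [norm_mul, Complex.norm_real, Real.norm_of_nonneg hk0]
      nlinarith [norm_nonneg w]
    have h1 : HasDerivAt (fun w : ℂ => (k : ℂ) * w) (k * 1) w := (hasDerivAt_id w).const_mul _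
    have h2 := (hP _ hkw).comp w h1
    rw [mul_one] at h2
    exact (hP _ hw).sub h2
  have hcl : closedBall z (d / 2) ⊆ ball 0 1 := by
    intro w hw
    rw [mem_closedBall, dist_eq_norm] at hw
    rw [mem_ball_zero_iff]
    have := norm_le_norm_add_norm_sub z w
    rw [norm_sub_rev] at this
    linarith
  have hDd : DiffContOnCl ℂ (fun w => P w - P (k * w)) (ball z (d / 2)) := by
    apply DifferentiableOn.diffContOnCl
    rw [closure_ball _ (by positivity)]
    exact fun w hw => (hDer w (hcl hw)).differentiableAt.differentiableWithinAt
  have hbd := Complex.norm_deriv_le_of_forall_mem_sphere_norm_le (by positivity) hDd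
    (C := (2 + M) * (d * c)) (fun w hw => key w (by
      simpa using hcl (sphere_subset_closedBall hw)))
  rw [(hDer z (by simpa using hzlt)).deriv] at hbd
  have e2 : (2 + M) * (d * c) / (d / 2) = 2 * (2 + M) * c := by field_simp
  rw [e2] at hbd
  have h3 : ‖f z‖ ≤ ‖f (k * z) * k‖ + ‖f z - f (k * z) * k‖ := by
    have := norm_add_le (f (k * z) * k) (f z - f (k * z) * k)
    simpa using this
  have h4 : ‖f (k * z) * k‖ ≤ ‖f (k * z)‖ := by
    rw [norm_mul, Complex.norm_real, Real.norm_of_nonneg hk0]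
    exact mul_le_of_le_one_right (norm_nonneg _) hk1
  linarith

open Filter Topology Metric Set in
lemma aux_bound (p : ℝ) (hp : 1 ≤ p) (f : ℂ → ℂ)
    (hf : DifferentiableOn ℂ f (Metric.ball (0 : ℂ) 1)) (M : ℝ) (_hM0 : 0 ≤ M)
    (hM : ∀ σ : ℂ, ‖σ‖ = 1 →
      IntegrableOn (fun r : ℝ => ‖f (r * σ)‖ ^ p) (Ioo 0 1) ∧
      ∫ r in Ioo (0 : ℝ) 1, ‖f (r * σ)‖ ^ p ≤ M) :
    ∃ K : ℝ, 0 < K ∧ ∀ z : ℂ, ‖z‖ < 1 → ‖f z‖ ≤ K * (1 - ‖z‖) ^ (-(1 / p)) := by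
  have hp0 : 0 < p := by linarith
  have hs0 : 0 < 1 / p := by positivity
  obtain ⟨K₀, hK₀⟩ := (isCompact_closedBall (0 : ℂ) (1 / 2)).exists_bound_of_continuousOn
    (hf.continuousOn.mono (closedBall_subset_ball (by norm_num)))
  set q : ℝ := 2 ^ (-(1 / p)) with hq
  have hq1 : q < 1 := Real.rpow_lt_one_of_one_lt_of_neg (by norm_num) (by linarith)
  set C : ℝ := 2 * (2 + M) with hC
  set K : ℝ := max (max K₀ 1) (C / (1 - q)) with hK
  have hK1 : 0 < K := lt_of_lt_of_le one_pos ((le_max_right _ _).trans (le_max_left _ _))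
  have hKC : K * q + C ≤ K := by
    have : C / (1 - q) ≤ K := le_max_right _ _
    rw [div_le_iff₀ (by linarith)] at this
    linarith
  refine ⟨K, hK1, ?_⟩
  have hbase : ∀ z : ℂ, ‖z‖ ≤ 1 / 2 → ‖f z‖ ≤ K * (1 - ‖z‖) ^ (-(1 / p)) := by
    intro z hz
    have h1 : ‖f z‖ ≤ K₀ := hK₀ z (by simpa using hz)
    have h2 : K₀ ≤ K := (le_max_left _ _).trans (le_max_left _ _)
    have h3 : 1 ≤ (1 - ‖z‖) ^ (-(1 / p)) :=
      Real.one_le_rpow_of_pos_of_le_one_of_nonpos (by linarith) (by linarith [norm_nonneg z])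
        (by linarith)
    nlinarith
  have hind : ∀ n : ℕ, ∀ z : ℂ, ‖z‖ < 1 → 1 ≤ 2 ^ (n + 1) * (1 - ‖z‖) →
      ‖f z‖ ≤ K * (1 - ‖z‖) ^ (-(1 / p)) := by
    intro n
    induction n with
    | zero =>
      intro z _ h
      exact hbase z (by norm_num at h; linarith)
    | succ n ih =>
      intro z hz h
      rcases le_or_gt ‖z‖ (1 / 2) with h' | h'
      · exact hbase z h'
      · set d : ℝ := 1 - ‖z‖ with hd
        have hd0 : 0 < d := by linarith
        obtain ⟨z', hz', hle⟩ := aux_step p hp f hf M hM z d hd0 (by linarith) (by linarith)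
        have h1 := ih z' (by linarith) (by rw [hz']; rw [pow_succ] at h; linarith)
        have h2 : 1 - ‖z'‖ = 2 * d := by rw [hz']; ring
        rw [h2, Real.mul_rpow (by norm_num) hd0.le, ← hq] at h1
        have h3 : 0 < d ^ (-(1 / p)) := Real.rpow_pos_of_pos hd0 _
        rw [← hC] at hle
        nlinarith
  intro z hz
  have hd0 : 0 < 1 - ‖z‖ := by linarith
  obtain ⟨n, hn⟩ := pow_unbounded_of_one_lt (1 / (1 - ‖z‖)) (one_lt_two : (1 : ℝ) < 2)
  refine hind n z hz ?_
  rw [div_lt_iff₀ hd0] at hn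
  rw [pow_succ]
  nlinarith

open Filter Topology Metric Set in
lemma aux_radial (p : ℝ) (hp : 1 ≤ p) (f : ℂ → ℂ)
    (hf : DifferentiableOn ℂ f (Metric.ball (0 : ℂ) 1)) (σ : ℂ) (hσ : ‖σ‖ = 1)
    (hintg : IntegrableOn (fun r : ℝ => ‖f (r * σ)‖ ^ p) (Ioo 0 1)) (K : ℝ) (hK0 : 0 < K)
    (hK : ∀ z : ℂ, ‖z‖ < 1 → ‖f z‖ ≤ K * (1 - ‖z‖) ^ (-(1 / p))) :
    Tendsto (fun d : ℝ => ‖f (((1 - d : ℝ) : ℂ) * σ)‖ * d ^ (1 / p)) (𝓝[>] 0) (𝓝 0) := by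
  have hp0 : 0 < p := by linarith
  have hs0 : 0 < 1 / p := by positivity
  have hs1 : 1 / p ≤ 1 := (div_le_one hp0).2 hp
  rw [Metric.tendsto_nhds]
  intro ε hε
  set η : ℝ := min (1 / 4) (ε / (16 * K)) with hη
  have hη0 : 0 < η := by positivity
  have hη1 : η ≤ 1 / 4 := min_le_left _ _
  have hη2 : 8 * K * η ≤ ε / 2 := by
    have : η ≤ ε / (16 * K) := min_le_right _ _
    rw [le_div_iff₀ (by positivity)] at this
    linarith
  -- the tail of the integral is small
  have htail : Tendsto (fun d : ℝ => ∫ t in Ioo (1 - d) 1, ‖f (t * σ)‖ ^ p) (𝓝[>] 0) (𝓝 0) := by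
    have hmeas : Tendsto (fun d : ℝ => (volume.restrict (Ioo (0 : ℝ) 1)) (Ioo (1 - d) 1))
        (𝓝[>] 0) (𝓝 0) := by
      have h1 : Tendsto (fun d : ℝ => ENNReal.ofReal d) (𝓝[>] 0) (𝓝 0) := by
        have := (ENNReal.continuous_ofReal.tendsto 0).mono_left
          (nhdsWithin_le_nhds (a := (0 : ℝ)) (s := Ioi 0))
        simpa using this
      refine tendsto_of_tendsto_of_tendsto_of_le_of_le tendsto_const_nhds h1
        (fun _ => zero_le) (fun d => ?_)
      refine (Measure.restrict_apply_le _ _).trans ?_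
      simp
    have h2 := hintg.tendsto_setIntegral_nhds_zero hmeas
    refine h2.congr' ?_
    filter_upwards [Ioo_mem_nhdsGT (zero_lt_one' ℝ)] with d hd
    rw [Measure.restrict_restrict measurableSet_Ioo,
      inter_eq_left.2 (Ioo_subset_Ioo_left (by linarith [hd.2]))]
  have hsmall := htail.eventually (gt_mem_nhds (show 0 < (ε / 2) ^ p * η by positivity))
  filter_upwards [hsmall, Ioo_mem_nhdsGT (zero_lt_one' ℝ)] with d hd hd01
  obtain ⟨hd0, hd1⟩ := hd01
  rw [dist_zero_right, Real.norm_of_nonneg (by positivity)]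
  by_contra! hcon
  set D : ℝ := d ^ (-(1 / p)) with hD
  have hD0 : 0 < D := Real.rpow_pos_of_pos hd0 _
  have hDd : d ^ (1 / p) * D = 1 := by rw [hD, ← Real.rpow_add hd0]; simp
  have hDp : D ^ p = d⁻¹ := by
    rw [hD, ← Real.rpow_mul hd0.le, show -(1 / p) * p = -1 by field_simp, Real.rpow_neg_one]
  set z : ℂ := ((1 - d : ℝ) : ℂ) * σ with hz
  have hzn : ‖z‖ = 1 - d := by
    rw [hz, norm_mul, hσ, mul_one, Complex.norm_real, Real.norm_of_nonneg (by linarith)]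
  have hlow : ε * D ≤ ‖f z‖ := by
    have := mul_le_mul_of_nonneg_right hcon hD0.le
    rwa [mul_assoc, hDd, mul_one] at this
  have hnear : ∀ w ∈ ball z (d / 2), d / 2 ≤ 1 - ‖w‖ := by
    intro w hw
    rw [mem_ball, dist_eq_norm] at hw
    have := norm_le_norm_add_norm_sub z w
    rw [norm_sub_rev] at this
    linarith
  have hbd : ∀ w ∈ ball z (d / 2), ‖f w‖ ≤ 2 * K * D := by
    intro w hw
    have h1 := hnear w hw
    have h2 := hK w (by linarith)
    have h3 : (1 - ‖w‖) ^ (-(1 / p)) ≤ (d / 2) ^ (-(1 / p)) :=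
      Real.rpow_le_rpow_of_nonpos (by linarith) h1 (by linarith)
    have h4 : (d / 2) ^ (-(1 / p)) ≤ 2 * D := by
      rw [Real.div_rpow hd0.le (by norm_num), Real.rpow_neg (by norm_num : (0 : ℝ) ≤ 2),
        div_inv_eq_mul, ← hD, mul_comm]
      have : (2 : ℝ) ^ (1 / p) ≤ 2 ^ (1 : ℝ) :=
        Real.rpow_le_rpow_of_exponent_le (by norm_num) hs1
      rw [Real.rpow_one] at this
      gcongr
    nlinarith
  have hsub : ball z (d / 2) ⊆ ball 0 1 := by
    intro w hw
    rw [mem_ball_zero_iff]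
    linarith [hnear w hw]
  have hseg : ∀ t ∈ Ioo (1 - d) (1 - d + η * d), (ε / 2) ^ p * d⁻¹ ≤ ‖f (t * σ)‖ ^ p := by
    intro t ht
    have hdist : dist ((t : ℂ) * σ) z ≤ η * d := by
      rw [dist_eq_norm, hz, ← sub_mul, norm_mul, hσ, mul_one, ← Complex.ofReal_sub,
        Complex.norm_real, Real.norm_of_nonneg (by linarith [ht.1])]
      linarith [ht.2]
    have hmem : (t : ℂ) * σ ∈ ball z (d / 2) := by
      rw [mem_ball]; nlinarith
    have h1 := aux_lip (hf.mono hsub) hbd hmem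
    have h2 : 2 * (2 * K * D) / (d / 2) * dist ((t : ℂ) * σ) z ≤ 8 * K * η * D := by
      calc 2 * (2 * K * D) / (d / 2) * dist ((t : ℂ) * σ) z
          ≤ 2 * (2 * K * D) / (d / 2) * (η * d) := by gcongr
        _ = 8 * K * η * D := by field_simp; ring
    have h3 : 8 * K * η * D ≤ ε / 2 * D := by gcongr
    have h4 : ‖f z‖ - ‖f (t * σ)‖ ≤ dist (f (t * σ)) (f z) := by
      rw [dist_comm, dist_eq_norm]; exact norm_sub_norm_le _ _
    have h5 : ε / 2 * D ≤ ‖f (t * σ)‖ := by linarith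
    rw [← hDp, ← Real.mul_rpow (by positivity) hD0.le]
    exact Real.rpow_le_rpow (by positivity) h5 hp0.le
  have hintg' : IntegrableOn (fun r : ℝ => ‖f (r * σ)‖ ^ p) (Ioo (1 - d) 1) :=
    hintg.mono_set (Ioo_subset_Ioo_left (by linarith))
  have hsub2 : Ioo (1 - d) (1 - d + η * d) ⊆ Ioo (1 - d) 1 :=
    Ioo_subset_Ioo_right (by nlinarith)
  have hI1 : ∫ t in Ioo (1 - d) (1 - d + η * d), ‖f (t * σ)‖ ^ p ≤
      ∫ t in Ioo (1 - d) 1, ‖f (t * σ)‖ ^ p :=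
    setIntegral_mono_set hintg' (Eventually.of_forall fun r => by positivity) hsub2.eventuallyLE
  have hI2 : ∫ t in Ioo (1 - d) (1 - d + η * d), (ε / 2) ^ p * d⁻¹ ≤
      ∫ t in Ioo (1 - d) (1 - d + η * d), ‖f (t * σ)‖ ^ p :=
    setIntegral_mono_on (integrableOn_const (by simp)) (hintg'.mono_set hsub2)
      measurableSet_Ioo hseg
  have hI3 : ∫ t in Ioo (1 - d) (1 - d + η * d), (ε / 2) ^ p * d⁻¹ = (ε / 2) ^ p * η := by
    rw [setIntegral_const, measureReal_def, Real.volume_Ioo, ENNReal.toReal_ofReal (by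
      have : 0 ≤ η * d := by positivity
      linarith), smul_eq_mul]
    field_simp
    ring
  linarith

/-- For `1 ≤ p < ∞` and `f ∈ RM(p,∞)`, the nontangential limit of
`f(z)(1 - σ̄ z)^{1/p}` at every boundary point `σ` is `0`; in particular
`|f(r)|(1-r)^{1/p} → 0` as `r → 1⁻` (the case `σ = 1`). -/
theorem stmt_16 (p : ℝ) (hp : 1 ≤ p) (f : ℂ → ℂ)
    (hf : DifferentiableOn ℂ f (Metric.ball (0 : ℂ) 1))
    (hfin : rhoE (ENNReal.ofReal p) ⊤ f ≠ ⊤) :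
    (∀ σ : ℂ, ‖σ‖ = 1 → ∀ R : ℝ, 1 < R →
        Filter.Tendsto (fun z => f z * (1 - (starRingEnd ℂ) σ * z) ^ ((1 / p : ℂ)))
          (nhdsWithin σ {z : ℂ | ‖z‖ < 1 ∧ ‖σ - z‖ < R * (1 - ‖z‖)})
          (nhds 0)) ∧
      Filter.Tendsto (fun r : ℝ => ‖f (r : ℂ)‖ * (1 - r) ^ (1 / p))
        (nhdsWithin 1 (Set.Iio 1)) (nhds 0) := by
  have hp0 : 0 < p := by linarith
  have hs0 : 0 < 1 / p := by positivity
  obtain ⟨M, hM0, hM⟩ := aux_int p hp f hf hfin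
  obtain ⟨K, hK0, hK⟩ := aux_bound p hp f hf M hM0 hM
  have hrad := fun σ hσ => aux_radial p hp f hf σ hσ (hM σ hσ).1 K hK0 hK
  constructor
  · intro σ hσ R hR
    have hR0 : 0 < R := by linarith
    set c : ℝ := Real.sqrt (1 - 1 / R ^ 2) with hc
    have hR2 : 0 < 1 / R ^ 2 := by positivity
    have hc0 : 0 ≤ c := Real.sqrt_nonneg _
    have hc1 : c < 1 := by
      rw [hc, Real.sqrt_lt' one_pos]; linarith
    set c' : ℝ := (1 + c) / 2 with hc'
    have hc'1 : c' < 1 := by linarith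
    have hc'0 : 0 < c' := by linarith
    set u : ℂ → ℂ := fun z => 1 - (starRingEnd ℂ) σ * z with hu
    set δ : ℂ → ℝ := fun z => R * ‖u z‖ with hδ
    set S : Set ℂ := {z : ℂ | ‖z‖ < 1 ∧ ‖σ - z‖ < R * (1 - ‖z‖)} with hS
    set l := nhdsWithin σ S with hl
    have hσσ : σ * (starRingEnd ℂ) σ = 1 := by
      rw [Complex.mul_conj, Complex.normSq_eq_norm_sq, hσ]; simp
    have hzu : ∀ z, z = σ * (1 - u z) := by
      intro z
      simp only [hu]
      linear_combination (-z) * hσσ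
    have hun : ∀ z, ‖u z‖ = ‖σ - z‖ := by
      intro z
      have : σ - z = σ * u z := by
        conv_lhs => rw [hzu z]
        ring
      rw [this, norm_mul, hσ, one_mul]
    have hupos : ∀ z ∈ S, 0 < ‖u z‖ := by
      intro z hz
      rw [norm_pos_iff]
      intro h0
      have h1 := hzu z
      rw [h0, sub_zero, mul_one] at h1
      have := hz.1
      rw [h1, hσ] at this
      exact lt_irrefl _ this
    have hδ0 : Filter.Tendsto δ l (nhds 0) := by
      have : Continuous δ := by fun_prop
      have h2 := (this.tendsto σ).mono_left (nhdsWithin_le_nhds (s := S))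
      have h3 : δ σ = 0 := by simp only [hδ, hun]; simp
      rwa [h3] at h2
    have hδpos : ∀ᶠ z in l, 0 < δ z := by
      filter_upwards [self_mem_nhdsWithin] with z hz
      exact mul_pos hR0 (hupos z hz)
    have hδlt : ∀ᶠ z in l, δ z < 1 := hδ0.eventually (gt_mem_nhds one_pos)
    set F : ℂ → ℂ → ℂ := fun z w =>
      ((δ z ^ (1 / p) : ℝ) : ℂ) * f (((1 - δ z : ℝ) + (δ z * c' : ℝ) * w) * σ) with hF
    set W : ℂ → ℂ := fun z => (1 - u z / ((R * ‖u z‖ : ℝ) : ℂ)) / (c' : ℂ) with hW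
    have hpt : ∀ d : ℝ, 0 < d → d < 1 → ∀ w : ℂ, ‖w‖ < 1 →
        ‖(((1 - d : ℝ) : ℂ) + (d * c' : ℝ) * w) * σ‖ ≤ 1 - d * (1 - c') := by
      intro d h0 h1 w hw
      rw [norm_mul, hσ, mul_one]
      refine (norm_add_le _ _).trans ?_
      rw [norm_mul, Complex.norm_real, Complex.norm_real, Real.norm_of_nonneg (by linarith),
        Real.norm_of_nonneg (by positivity)]
      have : d * c' * ‖w‖ ≤ d * c' * 1 := by gcongr
      linarith
    have hv := aux_vitali l F (K * (1 - c') ^ (-(1 / p))) ?_ ?_ ?_ (c / c')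
      ((div_lt_one hc'0).2 (by linarith)) W ?_
    · -- conclusion
      rw [tendsto_zero_iff_norm_tendsto_zero] at hv ⊢
      have hv2 := hv.const_mul (R ^ (-(1 / p)))
      rw [mul_zero] at hv2
      refine hv2.congr' ?_
      filter_upwards [self_mem_nhdsWithin] with z hz
      have hup := hupos z hz
      have hc'c : (c' : ℂ) ≠ 0 := by exact_mod_cast hc'0.ne'
      have e1 : (((1 - δ z : ℝ) : ℂ) + (δ z * c' : ℝ) * W z) * σ = z := by
        conv_rhs => rw [hzu z]
        have hδc : ((R * ‖u z‖ : ℝ) : ℂ) ≠ 0 := by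
          exact_mod_cast (mul_pos hR0 hup).ne'
        simp only [hW, hδ]
        generalize ((R * ‖u z‖ : ℝ)) = D at hδc ⊢
        push_cast
        field_simp
        ring
      have e2 : ‖u z ^ ((1 / p : ℂ))‖ = ‖u z‖ ^ (1 / p) := by
        have : ((1 / p : ℂ)) = ((1 / p : ℝ) : ℂ) := by push_cast; rfl
        rw [this, Complex.norm_cpow_real]
      show R ^ (-(1 / p)) * ‖F z (W z)‖ = ‖f z * u z ^ ((1 / p : ℂ))‖
      simp only [hF]
      rw [e1, norm_mul, norm_mul, e2, Complex.norm_real, Real.norm_of_nonneg (by positivity)]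
      simp only [hδ]
      rw [Real.mul_rpow hR0.le hup.le, Real.rpow_neg hR0.le]
      have : R ^ (1 / p) ≠ 0 := (Real.rpow_pos_of_pos hR0 _).ne'
      field_simp
    · filter_upwards [hδpos, hδlt] with z h0 h1
      refine DifferentiableOn.const_mul ?_ _
      refine hf.comp (by fun_prop) ?_
      intro w hw
      rw [mem_ball_zero_iff] at hw ⊢
      refine lt_of_le_of_lt (hpt _ h0 h1 w hw) ?_
      have : 0 < δ z * (1 - c') := mul_pos h0 (by linarith)
      linarith
    · filter_upwards [hδpos, hδlt] with z h0 h1 w hw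
      rw [mem_ball_zero_iff] at hw
      have h2 := hpt _ h0 h1 w hw
      have h3 : 0 < δ z * (1 - c') := mul_pos h0 (by linarith)
      have h4 := hK _ (lt_of_le_of_lt h2 (by linarith))
      simp only [hF]
      rw [norm_mul, Complex.norm_real, Real.norm_of_nonneg (by positivity)]
      have h5 := Real.rpow_le_rpow_of_nonpos h3 (le_sub_comm.1 h2)
        (show -(1 / p) ≤ 0 by linarith)
      rw [Real.mul_rpow h0.le (by linarith)] at h5
      have h6 : δ z ^ (1 / p) * δ z ^ (-(1 / p)) = 1 := by
        rw [← Real.rpow_add h0]; simp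
      calc δ z ^ (1 / p) * ‖f ((((1 - δ z : ℝ) : ℂ) + (δ z * c' : ℝ) * w) * σ)‖
          ≤ δ z ^ (1 / p) * (K * (δ z ^ (-(1 / p)) * (1 - c') ^ (-(1 / p)))) := by
            gcongr
            exact h4.trans (by gcongr)
        _ = (δ z ^ (1 / p) * δ z ^ (-(1 / p))) * (K * (1 - c') ^ (-(1 / p))) := by ring
        _ = K * (1 - c') ^ (-(1 / p)) := by rw [h6, one_mul]
    · intro x hx0 hx1
      have hb : 0 < 1 - c' * x := by nlinarith
      have ht : Filter.Tendsto (fun z => δ z * (1 - c' * x)) l (nhdsWithin 0 (Set.Ioi 0)) := by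
        refine tendsto_nhdsWithin_iff.2 ⟨?_, ?_⟩
        · simpa using hδ0.mul_const (1 - c' * x)
        · filter_upwards [hδpos] with z h0 using mul_pos h0 hb
      have h1 := ((hrad σ hσ).comp ht).const_mul ((1 - c' * x) ^ (-(1 / p)))
      rw [mul_zero] at h1
      rw [tendsto_zero_iff_norm_tendsto_zero]
      refine h1.congr' ?_
      filter_upwards [hδpos] with z h0
      simp only [hF, Function.comp]
      have e : (((1 - δ z : ℝ) : ℂ) + (δ z * c' : ℝ) * (x : ℂ)) =
          ((1 - δ z * (1 - c' * x) : ℝ) : ℂ) := by push_cast; ring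
      rw [e, norm_mul, Complex.norm_real, Real.norm_of_nonneg (by positivity),
        Real.mul_rpow h0.le hb.le, Real.rpow_neg hb.le]
      have : (1 - c' * x) ^ (1 / p) ≠ 0 := (Real.rpow_pos_of_pos hb _).ne'
      field_simp
    · filter_upwards [self_mem_nhdsWithin] with z hz
      have hup := hupos z hz
      simp only [hW]
      rw [norm_div, Complex.norm_real, Real.norm_of_nonneg hc'0.le]
      gcongr
      rw [hc]
      apply Real.le_sqrt_of_sq_le
      have hre : ‖u z‖ / R ≤ (u z).re := by
        have h1 := hz.2
        rw [← hun] at h1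
        have h2 : ((starRingEnd ℂ) σ * z).re ≤ ‖z‖ := by
          refine (Complex.re_le_norm _).trans ?_
          rw [norm_mul, RCLike.norm_conj, hσ, one_mul]
        have h3 : (u z).re = 1 - ((starRingEnd ℂ) σ * z).re := by simp [hu]
        rw [div_le_iff₀ hR0, h3]
        nlinarith
      have hns : ‖u z‖ ^ 2 = (u z).re ^ 2 + (u z).im ^ 2 := by
        rw [← Complex.normSq_eq_norm_sq, Complex.normSq_apply]; ring
      rw [← Complex.normSq_eq_norm_sq, Complex.normSq_apply, Complex.sub_re, Complex.sub_im,
        Complex.div_ofReal_re, Complex.div_ofReal_im, Complex.one_re, Complex.one_im]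
      generalize (u z).re = a at *
      generalize (u z).im = b at *
      generalize ‖u z‖ = m at *
      have e : (1 - a / (R * m)) * (1 - a / (R * m)) + (0 - b / (R * m)) * (0 - b / (R * m))
          = 1 - 2 * a / (R * m) + (a ^ 2 + b ^ 2) / (R * m) ^ 2 := by ring
      rw [e, ← hns]
      have e2 : m ^ 2 / (R * m) ^ 2 = 1 / R ^ 2 := by field_simp
      rw [e2]
      have h5 : 1 / R ^ 2 ≤ a / (R * m) := by
        calc 1 / R ^ 2 = (m / R) / (R * m) := by field_simp
          _ ≤ a / (R * m) := by gcongr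
      have e3 : 2 * a / (R * m) = 2 * (a / (R * m)) := by ring
      linarith
  · have h1 := hrad 1 (by simp)
    have ht : Filter.Tendsto (fun r : ℝ => 1 - r) (nhdsWithin 1 (Set.Iio 1))
        (nhdsWithin 0 (Set.Ioi 0)) := by
      refine tendsto_nhdsWithin_iff.2 ⟨?_, ?_⟩
      · have : Continuous (fun r : ℝ => 1 - r) := by fun_prop
        exact (this.tendsto' 1 0 (by simp)).mono_left nhdsWithin_le_nhds
      · filter_upwards [self_mem_nhdsWithin] with r hr
        simpa using hr
    refine (h1.comp ht).congr (fun r => ?_)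
    simp [Function.comp]
end
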